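/- arXiv:1605.09038 — 7 statements merged into one kernel-verified Lean document; each statement's English description precedes it below -/
import Mathlib

section
/- Let k, n, d be positive integers with 2k ≤ n. If 16·k·n·(Σ_{i=0}^{d} C(k,i)) ≤ 2^k, then there exists a binary sequence x ∈ {0,1}^n such that for every pair of distinct phases m₁ ≠ m₂ in {1,…,n}, the Hamming distance between the length-k cyclic windows φ(m₁) and φ(m₂) is strictly greater than d. -/
/-- Length-`k` cyclic window of the sequence `x` (indexed cyclically by `ZMod n`)
starting at phase `m`: `(x_m, x_{m+1}, …, x_{m+k-1})` with indices modulo `n`. -/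
def win {α : Type*} {n : ℕ} (k : ℕ) (x : ZMod n → α) (m : ZMod n) : Fin k → α :=
  fun i => x (m + ((i : ℕ) : ZMod n))

/-- A counting form of the symmetric Lovász local lemma: if a bad event `A i` has relative
frequency at most `v / q` among the points avoiding any family of events outside the
neighbourhood `nbr i`, then some point avoids every event. -/
theorem exists_forall_not_of_local {ι Ω : Type*} [Fintype ι] [DecidableEq ι] [Fintype Ω]
    [Nonempty Ω] (A : ι → Ω → Prop) [∀ i, DecidablePred (A i)] (nbr : ι → Finset ι)
    (q v D : ℕ) (hq : 2 * v < q) (hD : 4 * v * D ≤ q) (hnbr : ∀ i, (nbr i).card ≤ D)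
    (hA : ∀ (i : ι) (S : Finset ι), Disjoint S (nbr i) →
      q * (Finset.univ.filter fun x => A i x ∧ ∀ j ∈ S, ¬ A j x).card ≤
        v * (Finset.univ.filter fun x => ∀ j ∈ S, ¬ A j x).card) :
    ∃ x, ∀ i, ¬ A i x := by
  classical
  have key : ∀ (S : Finset ι) (i : ι),
      q * (Finset.univ.filter fun x => A i x ∧ ∀ j ∈ S, ¬ A j x).card ≤
        2 * v * (Finset.univ.filter fun x => ∀ j ∈ S, ¬ A j x).card := by
    intro S
    induction S using Finset.strongInduction with
    | H S ih =>
      intro i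
      have hdisj : Disjoint (S \ nbr i) (nbr i) := Finset.sdiff_disjoint
      have h₂ := hA i (S \ nbr i) hdisj
      by_cases hS : S \ nbr i = S
      · rw [hS] at h₂
        nlinarith
      have hss : S \ nbr i ⊂ S := Finset.sdiff_subset.ssubset_of_ne hS
      have hmono : (Finset.univ.filter fun x => A i x ∧ ∀ j ∈ S, ¬ A j x).card ≤
          (Finset.univ.filter fun x => A i x ∧ ∀ j ∈ S \ nbr i, ¬ A j x).card := by
        apply Finset.card_le_card
        intro x
        simp only [Finset.mem_filter, Finset.mem_univ, true_and]
        exact fun hx => ⟨hx.1, fun j hj => hx.2 j (Finset.sdiff_subset hj)⟩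
      have hcover : (Finset.univ.filter fun x => ∀ j ∈ S \ nbr i, ¬ A j x).card ≤
          (Finset.univ.filter fun x => ∀ j ∈ S, ¬ A j x).card +
          ∑ j ∈ nbr i,
            (Finset.univ.filter fun x => A j x ∧ ∀ l ∈ S \ nbr i, ¬ A l x).card := by
        refine le_trans (Finset.card_le_card ?_) ((Finset.card_union_le _ ((nbr i).biUnion
          fun j => Finset.univ.filter fun x => A j x ∧ ∀ l ∈ S \ nbr i, ¬ A l x)).trans
          (Nat.add_le_add_left Finset.card_biUnion_le _))
        intro x
        simp only [Finset.mem_filter, Finset.mem_univ, true_and, Finset.mem_union,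
          Finset.mem_biUnion, Finset.mem_sdiff]
        intro hx
        by_cases hall : ∃ j ∈ nbr i, A j x
        · obtain ⟨j, hj, hjx⟩ := hall
          exact Or.inr ⟨j, hj, hjx, hx⟩
        · refine Or.inl fun j hj hjx => ?_
          by_cases hji : j ∈ nbr i
          · exact hall ⟨j, hji, hjx⟩
          · exact hx j ⟨hj, hji⟩ hjx
      have hsum : q * ∑ j ∈ nbr i,
          (Finset.univ.filter fun x => A j x ∧ ∀ l ∈ S \ nbr i, ¬ A l x).card ≤
          D * (2 * v * (Finset.univ.filter fun x => ∀ j ∈ S \ nbr i, ¬ A j x).card) := by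
        rw [Finset.mul_sum]
        refine (Finset.sum_le_card_nsmul _ _ _ fun j _ => ih _ hss j).trans ?_
        rw [smul_eq_mul]
        exact Nat.mul_le_mul_right _ (hnbr i)
      generalize (Finset.univ.filter fun x => ∀ j ∈ S \ nbr i, ¬ A j x).card = a at *
      generalize (Finset.univ.filter fun x => ∀ j ∈ S, ¬ A j x).card = b at *
      generalize (∑ j ∈ nbr i,
        (Finset.univ.filter fun x => A j x ∧ ∀ l ∈ S \ nbr i, ¬ A l x).card) = s at *
      have hab : a ≤ 2 * b := by
        have h₁ : q * a ≤ q * b + q * s := by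
          rw [← mul_add]; exact Nat.mul_le_mul_left _ hcover
        have h₃ := Nat.mul_le_mul_right a hD
        refine le_of_mul_le_mul_left (a := q) ?_ (by omega)
        nlinarith
      calc _ ≤ _ := Nat.mul_le_mul_left q hmono
        _ ≤ v * a := h₂
        _ ≤ v * (2 * b) := Nat.mul_le_mul_left v hab
        _ = 2 * v * b := by ring
  have hpos : ∀ S : Finset ι, 0 < (Finset.univ.filter fun x => ∀ j ∈ S, ¬ A j x).card := by
    intro S
    induction S using Finset.induction_on with
    | empty => simp [Fintype.card_pos]
    | insert i S _ ih =>
      by_contra h0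
      have h0 : (Finset.univ.filter fun x => ∀ j ∈ insert i S, ¬ A j x).card = 0 := by omega
      have hle : (Finset.univ.filter fun x => ∀ j ∈ S, ¬ A j x).card ≤
          (Finset.univ.filter fun x => A i x ∧ ∀ j ∈ S, ¬ A j x).card := by
        apply Finset.card_le_card
        intro x
        rw [Finset.card_eq_zero, Finset.filter_eq_empty_iff] at h0
        have := h0 (Finset.mem_univ x)
        simp only [Finset.mem_filter, Finset.mem_univ, true_and, Finset.forall_mem_insert]
          at this ⊢
        tauto
      have := key S i
      nlinarith
  obtain ⟨x, hx⟩ := Finset.card_pos.1 (hpos Finset.univ)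
  exact ⟨x, fun i => (Finset.mem_filter.1 hx).2 i (Finset.mem_univ i)⟩

theorem exists_xor_shift_eq (t : ℕ) (ht : 0 < t) (e : ℕ → Bool) :
    ∃ f : ℕ → Bool, (∀ j < t, f j = false) ∧ ∀ i, (f i ^^ f (t + i)) = e i := by
  let f : ℕ → Bool := fun j =>
    Nat.strongRec (motive := fun _ => Bool)
      (fun j ih => if h : j < t then false else e (j - t) ^^ ih (j - t) (by omega)) j
  have hf : ∀ j, f j = if j < t then false else e (j - t) ^^ f (j - t) := by
    intro j
    simp only [f]
    conv_lhs => rw [Nat.strongRec]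
    split_ifs <;> rfl
  refine ⟨f, fun j hj => by rw [hf, if_pos hj], fun i => ?_⟩
  rw [hf (t + i), if_neg (by omega), Nat.add_sub_cancel_left]
  cases e i <;> cases f i <;> rfl

/-- Every difference pattern between the windows at `m₁` and `m₂` is realised by a sequence
supported on the window at `m₂`, provided that window does not wrap past `m₁`. -/
theorem exists_supported_diff {n k : ℕ} [NeZero n] {m₁ m₂ : ZMod n} (hm : m₁ ≠ m₂)
    (ht : (m₂ - m₁).val + k ≤ n) (e : Finset (Fin k)) :
    ∃ z : ZMod n → Bool, (∀ m, z m = true → ∃ i : Fin k, m = m₂ + ((i : ℕ) : ZMod n)) ∧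
      ∀ i : Fin k, (win k z m₁ i ^^ win k z m₂ i) = decide (i ∈ e) := by
  have htpos : 0 < (m₂ - m₁).val := by
    rw [Nat.pos_iff_ne_zero, Ne, ZMod.val_eq_zero, sub_eq_zero]
    exact hm.symm
  obtain ⟨f, hf0, hf⟩ := exists_xor_shift_eq _ htpos
    (fun j => if h : j < k then decide ((⟨j, h⟩ : Fin k) ∈ e) else false)
  set t := (m₂ - m₁).val with ht_def
  have hcast : (t : ZMod n) = m₂ - m₁ := ZMod.natCast_zmod_val _
  refine ⟨fun m => decide ((m - m₁).val < t + k) && f (m - m₁).val, fun m hz => ?_, fun i => ?_⟩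
  · simp only [Bool.and_eq_true, decide_eq_true_eq] at hz
    have hge : t ≤ (m - m₁).val := by
      by_contra hlt
      simp [hf0 _ (not_le.1 hlt)] at hz
    refine ⟨⟨(m - m₁).val - t, by omega⟩, ?_⟩
    rw [Nat.cast_sub hge, hcast, ZMod.natCast_zmod_val]
    ring
  · have hi := i.2
    have h₁ : (m₁ + ((i : ℕ) : ZMod n) - m₁).val = i := by
      rw [add_sub_cancel_left, ZMod.val_natCast_of_lt (by omega)]
    have h₂ : (m₂ + ((i : ℕ) : ZMod n) - m₁).val = t + i := by
      rw [show m₂ + ((i : ℕ) : ZMod n) - m₁ = ((t + i : ℕ) : ZMod n) by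
        rw [Nat.cast_add, hcast]; ring]
      exact ZMod.val_natCast_of_lt (by omega)
    have := hf i
    simp only [hi, dite_true] at this
    simp only [win, h₁, h₂]
    rw [decide_eq_true (show (i : ℕ) < t + k by omega),
      decide_eq_true (show t + (i : ℕ) < t + k by omega), Bool.true_and, Bool.true_and, this]

theorem exists_center_supported_diff {n k : ℕ} [NeZero n] (hkn : 2 * k ≤ n) {m₁ m₂ : ZMod n}
    (hm : m₁ ≠ m₂) :
    ∃ c : ZMod n, ∀ e : Finset (Fin k), ∃ z : ZMod n → Bool,
      (∀ m, z m = true → ∃ i : Fin k, m = c + ((i : ℕ) : ZMod n)) ∧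
      ∀ i : Fin k, (win k z m₁ i ^^ win k z m₂ i) = decide (i ∈ e) := by
  by_cases ht : (m₂ - m₁).val + k ≤ n
  · exact ⟨m₂, exists_supported_diff hm ht⟩
  · refine ⟨m₁, fun e => ?_⟩
    have ht' : (m₁ - m₂).val + k ≤ n := by
      have : NeZero (m₂ - m₁) := ⟨sub_ne_zero.2 hm.symm⟩
      rw [← neg_sub, ZMod.val_neg_of_ne_zero]
      omega
    obtain ⟨z, hz, hze⟩ := exists_supported_diff hm.symm ht' e
    exact ⟨z, hz, fun i => by rw [Bool.xor_comm]; exact hze i⟩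

theorem card_filter_card_le (k d : ℕ) :
    (Finset.univ.filter fun e : Finset (Fin k) => e.card ≤ d).card =
      ∑ i ∈ Finset.range (d + 1), k.choose i := by
  rw [Finset.card_eq_sum_card_fiberwise (f := Finset.card) (t := Finset.range (d + 1))]
  · refine Finset.sum_congr rfl fun i hi => ?_
    rw [Finset.mem_range] at hi
    have : ((Finset.univ.filter fun e : Finset (Fin k) => e.card ≤ d).filter
        fun e => e.card = i) = Finset.powersetCard i Finset.univ := by
      ext e
      simp only [Finset.mem_filter, Finset.mem_univ, true_and, Finset.mem_powersetCard,
        Finset.subset_univ]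
      omega
    rw [this, Finset.card_powersetCard, Finset.card_univ, Fintype.card_fin]
  · intro e he
    simp only [Finset.coe_filter, Finset.mem_univ, true_and, Set.mem_ofPred_eq] at he
    simp only [Finset.coe_range, Set.mem_Iio]
    omega

/-- Sequences satisfying `B` have close windows at `m₁` and `m₂` with relative frequency at most
that of a Hamming ball, if `B` only depends on coordinates outside the window at `c`. -/
theorem card_close_windows_le {n k : ℕ} [NeZero n] (d : ℕ) {m₁ m₂ c : ZMod n}
    (hc : ∀ e : Finset (Fin k), ∃ z : ZMod n → Bool,
      (∀ m, z m = true → ∃ i : Fin k, m = c + ((i : ℕ) : ZMod n)) ∧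
      ∀ i : Fin k, (win k z m₁ i ^^ win k z m₂ i) = decide (i ∈ e))
    (B : (ZMod n → Bool) → Prop) [DecidablePred B]
    (hB : ∀ x y : ZMod n → Bool,
      (∀ m, (∀ i : Fin k, m ≠ c + ((i : ℕ) : ZMod n)) → x m = y m) → B x → B y) :
    2 ^ k * (Finset.univ.filter fun x : ZMod n → Bool =>
        hammingDist (win k x m₁) (win k x m₂) ≤ d ∧ B x).card ≤
      (∑ i ∈ Finset.range (d + 1), k.choose i) * (Finset.univ.filter B).card := by
  choose z hz hze using hc
  have hpow : 2 ^ k = (Finset.univ : Finset (Finset (Fin k))).card := by simp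
  rw [← card_filter_card_le, hpow, ← Finset.card_product, ← Finset.card_product]
  refine Finset.card_le_card_of_injOn
    (fun p => (Finset.univ.filter fun i => win k p.2 m₁ i ≠ win k p.2 m₂ i,
      fun m => p.2 m ^^ z p.1 m)) ?_ ?_
  · rintro ⟨e, x⟩ hx
    simp only [Finset.coe_product, Set.mem_prod, Finset.mem_coe, Finset.mem_filter,
      Finset.mem_univ, true_and] at hx ⊢
    refine ⟨hx.1, hB x _ (fun m hm => ?_) hx.2⟩
    have : z e m = false := by
      by_contra h
      obtain ⟨i, hi⟩ := hz e m (by simpa using h)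
      exact hm i hi
    simp [this]
  · rintro ⟨e, x⟩ _ ⟨e', x'⟩ _ heq
    simp only [Prod.mk.injEq] at heq
    obtain ⟨h₁, h₂⟩ := heq
    have hee : e = e' := by
      ext i
      have ha := hze e i
      have hb := hze e' i
      have hi := Finset.ext_iff.1 h₁ i
      rw [Finset.mem_filter_univ, Finset.mem_filter_univ] at hi
      have hp := congrFun h₂ (m₁ + ((i : ℕ) : ZMod n))
      have hr := congrFun h₂ (m₂ + ((i : ℕ) : ZMod n))
      simp only [win] at ha hb hi hp hr
      rw [← decide_eq_decide (p := i ∈ e), ← ha, ← hb]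
      revert hi hp hr
      generalize x (m₁ + _) = a₁
      generalize x (m₂ + _) = a₂
      generalize x' (m₁ + _) = a₃
      generalize x' (m₂ + _) = a₄
      generalize z e (m₁ + _) = a₅
      generalize z e (m₂ + _) = a₆
      generalize z e' (m₁ + _) = a₇
      generalize z e' (m₂ + _) = a₈
      revert a₁ a₂ a₃ a₄ a₅ a₆ a₇ a₈
      decide
    subst hee
    refine Prod.ext rfl (funext fun m => ?_)
    simpa using congrFun h₂ m

theorem card_windows_meeting_le {n : ℕ} [NeZero n] (k : ℕ) (c : ZMod n) :
    (Finset.univ.filter fun m : ZMod n =>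
      ∃ i j : Fin k, m + ((j : ℕ) : ZMod n) = c + ((i : ℕ) : ZMod n)).card ≤ 2 * k := by
  refine (Finset.card_le_card
    (t := (Finset.range (2 * k)).image fun r : ℕ => c - (k : ZMod n) + (r : ZMod n)) ?_).trans
    (Finset.card_image_le.trans (Finset.card_range _).le)
  intro m hm
  obtain ⟨i, j, hij⟩ := (Finset.mem_filter.1 hm).2
  refine Finset.mem_image.2 ⟨i + (k - j), Finset.mem_range.2 (by omega), ?_⟩
  rw [Nat.cast_add, Nat.cast_sub j.2.le, eq_sub_of_add_eq hij]
  ring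

theorem stmt0 (k n d : ℕ) (hk : 0 < k) (hn : 0 < n) (hd : 0 < d)
    (hkn : 2 * k ≤ n)
    (h : 16 * k * n * (∑ i ∈ Finset.range (d + 1), k.choose i) ≤ 2 ^ k) :
    ∃ x : ZMod n → Bool, ∀ m₁ m₂ : ZMod n, m₁ ≠ m₂ →
      d < hammingDist (win k x m₁) (win k x m₂) := by
  classical
  have : NeZero n := ⟨hn.ne'⟩
  have hV : 0 < ∑ i ∈ Finset.range (d + 1), k.choose i :=
    Finset.sum_pos' (fun _ _ => Nat.zero_le _) ⟨0, by simp, by simp⟩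
  set V := ∑ i ∈ Finset.range (d + 1), k.choose i
  have hkn_pos : 0 < k * n := Nat.mul_pos hk hn
  let ι := {p : ZMod n × ZMod n // p.1 ≠ p.2}
  choose c hc using fun p : ι => exists_center_supported_diff (k := k) hkn p.2
  let M : ι → Finset (ZMod n) := fun p => Finset.univ.filter fun m : ZMod n =>
    ∃ i j : Fin k, m + ((j : ℕ) : ZMod n) = c p + ((i : ℕ) : ZMod n)
  have hM : ∀ p, (M p).card ≤ 2 * k := fun p => card_windows_meeting_le k (c p)
  let nbr : ι → Finset ι := fun p => Finset.univ.filter fun r => r.1.1 ∈ M p ∨ r.1.2 ∈ M p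
  let A : ι → (ZMod n → Bool) → Prop := fun p x =>
    hammingDist (win k x p.1.1) (win k x p.1.2) ≤ d
  have hcard : ∀ p, (nbr p).card ≤ 4 * k * n := by
    intro p
    have hle : (nbr p).card ≤
        ((M p ×ˢ Finset.univ) ∪ (Finset.univ ×ˢ M p) : Finset (ZMod n × ZMod n)).card := by
      refine Finset.card_le_card_of_injOn Subtype.val ?_ Subtype.val_injective.injOn
      intro r hr
      simpa [nbr] using hr
    refine hle.trans ((Finset.card_union_le _ _).trans ?_)
    rw [Finset.card_product, Finset.card_product, Finset.card_univ, ZMod.card]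
    nlinarith [hM p]
  suffices hloc : ∀ (p : ι) (S : Finset ι), Disjoint S (nbr p) →
      2 ^ k * (Finset.univ.filter fun x : ZMod n → Bool =>
        A p x ∧ ∀ r ∈ S, ¬ A r x).card ≤
      V * (Finset.univ.filter fun x : ZMod n → Bool => ∀ r ∈ S, ¬ A r x).card by
    obtain ⟨x, hx⟩ := exists_forall_not_of_local A nbr (2 ^ k) V (4 * k * n) (by nlinarith)
      (by nlinarith) hcard hloc
    exact ⟨x, fun m₁ m₂ hm => not_le.1 (hx ⟨(m₁, m₂), hm⟩)⟩
  intro p S hS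
  refine card_close_windows_le d (hc p) _ fun x y hxy hx r hr => ?_
  have hrn : r ∉ nbr p := Finset.disjoint_left.1 hS hr
  simp only [nbr, M, Finset.mem_filter, Finset.mem_univ, true_and, not_or, not_exists] at hrn
  have hwin : ∀ m : ZMod n,
      (∀ i j : Fin k, ¬ m + ((j : ℕ) : ZMod n) = c p + ((i : ℕ) : ZMod n)) →
      win k y m = win k x m :=
    fun m hm => funext fun j => (hxy _ fun i => hm i j).symm
  simp only [A, hwin _ hrn.1, hwin _ hrn.2]
  exact hx r hr
end

section
/- For every real p with 0 ≤ p < 1/4 and every real R with 0 < R < 1 − h(2p), there exists an integer K such that for every integer k ≥ K there exist an integer n ≥ 2^{Rk} and a binary sequence x ∈ {0,1}^n such that for every pair of distinct phases m₁ ≠ m₂ in {1,…,n}, the Hamming distance between the length-k cyclic windows φ(m₁) and φ(m₂) is strictly greater than 2pk. -/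
/-- Base-2 binary entropy function (with the convention `0 · log₂ 0 = 0`). -/
noncomputable def binEnt (q : ℝ) : ℝ :=
  -q * Real.logb 2 q - (1 - q) * Real.logb 2 (1 - q)

open Finset in
/-- The number of subsets of `Fin k` of size at most `q * k` is at most `2 ^ (binEnt q * k)`. -/
theorem card_small_subsets_le (q : ℝ) (hq0 : 0 ≤ q) (hq1 : q ≤ 1 / 2) (k : ℕ) :
    ((univ.filter fun s : Finset (Fin k) => (s.card : ℝ) ≤ q * k).card : ℝ)
      ≤ (2 : ℝ) ^ (binEnt q * k) := by
  have hterm : ∀ s : Finset (Fin k), (s.card : ℝ) ≤ q * k →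
      (2 : ℝ) ^ (-(binEnt q * k)) ≤ q ^ s.card * (1 - q) ^ (k - s.card) := by
    intro s hs
    have hsk : s.card ≤ k := by simpa using s.card_le_univ
    rcases hq0.eq_or_lt with rfl | hq
    · have h0 : s.card = 0 := by
        have : (s.card : ℝ) ≤ 0 := by simpa using hs
        exact_mod_cast this.antisymm (Nat.cast_nonneg _)
      simp [h0, binEnt]
    · have hq' : 0 < 1 - q := by linarith
      rw [← Real.log_le_log_iff (by positivity) (by positivity), Real.log_rpow two_pos,
        Real.log_mul (by positivity) (by positivity), Real.log_pow, Real.log_pow,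
        Nat.cast_sub hsk]
      have hlog : Real.log q ≤ Real.log (1 - q) := Real.log_le_log hq (by linarith)
      have hl2 : Real.log 2 ≠ 0 := (Real.log_pos one_lt_two).ne'
      have hE : -(binEnt q * k) * Real.log 2
          = q * k * Real.log q + (1 - q) * k * Real.log (1 - q) := by
        unfold binEnt Real.logb
        field_simp
        ring
      rw [hE]
      nlinarith [mul_nonneg (sub_nonneg.2 hs) (sub_nonneg.2 hlog)]
  have hsum : ∑ s : Finset (Fin k), q ^ s.card * (1 - q) ^ (k - s.card) = 1 := by
    have := Fintype.sum_pow_mul_eq_add_pow (Fin k) q (1 - q)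
    simpa using this
  have hle : ((univ.filter fun s : Finset (Fin k) => (s.card : ℝ) ≤ q * k).card : ℝ)
      * (2 : ℝ) ^ (-(binEnt q * k)) ≤ 1 := by
    rw [← hsum, ← nsmul_eq_mul, ← sum_const]
    refine (sum_le_sum fun s hs => hterm s (mem_filter.1 hs).2).trans ?_
    refine sum_le_sum_of_subset_of_nonneg (filter_subset _ _) fun s _ _ => ?_
    have : 0 ≤ 1 - q := by linarith
    positivity
  rwa [Real.rpow_neg two_pos.le, ← div_eq_mul_inv, div_le_one (by positivity)] at hle

namespace CyclicWindow

open Finset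

variable {n : ℕ}

/-- The set of positions covered by the cyclic window of length `k` at phase `i`. -/
def positions (k : ℕ) (i : ZMod n) : Finset (ZMod n) :=
  univ.image fun s : Fin k => i + ((s : ℕ) : ZMod n)

/-- The set of offsets at which the windows at phases `i` and `j` differ. -/
def disagreement (k : ℕ) (i j : ZMod n) (x : ZMod n → Bool) : Finset (Fin k) :=
  univ.filter fun s => win k x i s ≠ win k x j s

theorem mem_disagreement {k : ℕ} {i j : ZMod n} {x : ZMod n → Bool} {s : Fin k} :
    s ∈ disagreement k i j x ↔
      x (i + ((s : ℕ) : ZMod n)) ≠ x (j + ((s : ℕ) : ZMod n)) := by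
  rw [disagreement, mem_filter]
  simp only [mem_univ, true_and, win]

theorem mem_positions {k : ℕ} {i v : ZMod n} :
    v ∈ positions k i ↔ ∃ s < k, i + ((s : ℕ) : ZMod n) = v := by
  simp only [positions, mem_image, mem_univ, true_and]
  exact ⟨fun ⟨s, h⟩ => ⟨s, s.2, h⟩, fun ⟨s, hs, h⟩ => ⟨⟨s, hs⟩, h⟩⟩

theorem add_natCast_mem_positions {k : ℕ} (i : ZMod n) (s : Fin k) :
    i + ((s : ℕ) : ZMod n) ∈ positions k i :=
  mem_positions.2 ⟨s, s.2, rfl⟩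

theorem card_positions {k : ℕ} (hkn : k ≤ n) (i : ZMod n) : (positions k i).card = k := by
  rw [positions, card_image_of_injective, card_univ, Fintype.card_fin]
  intro s t hst
  have h : ((s : ℕ) : ZMod n) = ((t : ℕ) : ZMod n) := add_left_cancel hst
  rw [ZMod.natCast_eq_natCast_iff] at h
  exact Fin.ext (Nat.ModEq.eq_of_lt_of_lt h (by omega) (by omega))

theorem disagreement_congr {k : ℕ} {i j : ZMod n} {x y : ZMod n → Bool}
    (hi : ∀ v ∈ positions k i, x v = y v) (hj : ∀ v ∈ positions k j, x v = y v) :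
    disagreement k i j x = disagreement k i j y := by
  ext s
  simp [mem_disagreement, hi _ (add_natCast_mem_positions i s),
    hj _ (add_natCast_mem_positions j s)]

theorem disagreement_comm (k : ℕ) (i j : ZMod n) (x : ZMod n → Bool) :
    disagreement k i j x = disagreement k j i x := by
  ext s
  simp [mem_disagreement, ne_comm]

/-- A sequence is determined by its values outside one window together with the disagreement
pattern of that window with another one. -/
theorem eq_of_disagreement_eq [NeZero n] {k : ℕ} (hkn : 2 * k ≤ n) {i j : ZMod n} (hij : i ≠ j)
    {x y : ZMod n → Bool} (hout : ∀ v ∉ positions k i, x v = y v)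
    (hdis : disagreement k i j x = disagreement k i j y) : x = y := by
  classical
  by_contra hxy
  obtain ⟨v, hv⟩ := Function.ne_iff.1 hxy
  have hmem : ∀ v, x v ≠ y v → ∃ s < k, i + ((s : ℕ) : ZMod n) = v := fun v h =>
    mem_positions.1 (by by_contra h'; exact h (hout v h'))
  set d := (j - i).val with hd
  have hdn : d < n := ZMod.val_lt _
  have hd0 : 0 < d := by
    rw [hd, Nat.pos_iff_ne_zero, Ne, ZMod.val_eq_zero, sub_eq_zero]
    exact hij.symm
  have hj : j = i + (d : ZMod n) := by simp [hd]
  have hprop : ∀ s < k, x (i + ((s : ℕ) : ZMod n)) ≠ y (i + ((s : ℕ) : ZMod n)) →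
      ∃ t < k, s + d ≡ t [MOD n] ∧ x (i + ((t : ℕ) : ZMod n)) ≠ y (i + ((t : ℕ) : ZMod n)) := by
    intro s hs hne
    have h1 := Finset.ext_iff.1 hdis ⟨s, hs⟩
    simp only [mem_disagreement] at h1
    have h2 : x (j + (s : ZMod n)) ≠ y (j + (s : ZMod n)) := by
      revert h1 hne
      generalize x (i + (s : ZMod n)) = a
      generalize y (i + (s : ZMod n)) = b
      generalize x (j + (s : ZMod n)) = a'
      generalize y (j + (s : ZMod n)) = b'
      revert a b a' b'
      decide
    obtain ⟨t, ht, hjt⟩ := hmem _ h2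
    refine ⟨t, ht, ?_, by rwa [hjt]⟩
    rw [← ZMod.natCast_eq_natCast_iff]
    rw [hj, add_assoc] at hjt
    rw [add_left_cancel hjt]
    push_cast
    ring
  have hmod : ∀ s < k, ∀ t < k, s + d ≡ t [MOD n] → s + d = t ∨ s + d = t + n := by
    intro s hs t ht h
    rcases lt_or_ge (s + d) n with h' | h'
    · exact Or.inl (Nat.ModEq.eq_of_lt_of_lt h h' (by omega))
    · right
      have : s + d - n ≡ t [MOD n] := by
        have h2 : (s + d - n) + n ≡ t [MOD n] := by rwa [Nat.sub_add_cancel h']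
        simpa [Nat.ModEq] using h2
      have := Nat.ModEq.eq_of_lt_of_lt this (by omega) (by omega)
      omega
  set T := (range k).filter fun s : ℕ => x (i + (s : ZMod n)) ≠ y (i + (s : ZMod n)) with hT
  have hTne : T.Nonempty := by
    obtain ⟨s, hs, rfl⟩ := hmem v hv
    exact ⟨s, by simp [hT, hs, hv]⟩
  have hTstep : ∀ s ∈ T, ∃ t ∈ T, s + d = t ∨ s + d = t + n := by
    intro s hs
    obtain ⟨hs, hne⟩ := mem_filter.1 hs
    obtain ⟨t, ht, hst, hne'⟩ := hprop s (mem_range.1 hs) hne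
    exact ⟨t, mem_filter.2 ⟨mem_range.2 ht, hne'⟩, hmod s (mem_range.1 hs) t ht hst⟩
  have hTk : ∀ s ∈ T, s < k := fun s hs => mem_range.1 (mem_filter.1 hs).1
  rcases le_or_gt d (n - k) with hdk | hdk
  · obtain ⟨t, ht, h⟩ := hTstep _ (T.max'_mem hTne)
    have := T.le_max' t ht
    have := hTk _ (T.max'_mem hTne)
    omega
  · obtain ⟨t, ht, h⟩ := hTstep _ (T.min'_mem hTne)
    have := T.min'_le t ht
    have := hTk _ ht
    omega

open Classical in
/-- The sequences supported on `U` all of whose pairs of windows contained in `U` differ in more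
than `r` places. -/
noncomputable def admissible [NeZero n] (k : ℕ) (r : ℝ) (U : Finset (ZMod n)) :
    Finset (ZMod n → Bool) :=
  univ.filter fun x => (∀ v ∉ U, x v = false) ∧
    ∀ i j, i ≠ j → positions k i ⊆ U → positions k j ⊆ U → r < (disagreement k i j x).card

/-- The number of subsets of `Fin k` of size at most `r`. -/
noncomputable def ballSize (k : ℕ) (r : ℝ) : ℕ :=
  (univ.filter fun s : Finset (Fin k) => (s.card : ℝ) ≤ r).card

theorem mem_admissible [NeZero n] {k : ℕ} {r : ℝ} {U : Finset (ZMod n)} {x : ZMod n → Bool} :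
    x ∈ admissible k r U ↔ (∀ v ∉ U, x v = false) ∧
      ∀ i j, i ≠ j → positions k i ⊆ U → positions k j ⊆ U →
        r < (disagreement k i j x).card := by
  simp [admissible]

open Classical in
/-- The sequences supported on `insert t U` that violate only constraints involving `t`, and
violate the one for the windows at `i` and `j`. -/
noncomputable def violating [NeZero n] (k : ℕ) (r : ℝ) (U : Finset (ZMod n)) (t i j : ZMod n) :
    Finset (ZMod n → Bool) :=
  univ.filter fun x => ((∀ v ∉ insert t U, x v = false) ∧
    ∀ i j, i ≠ j → positions k i ⊆ U → positions k j ⊆ U → r < (disagreement k i j x).card) ∧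
    i ≠ j ∧ positions k i ⊆ insert t U ∧ ((disagreement k i j x).card : ℝ) ≤ r

theorem card_violating_le [NeZero n] {k : ℕ} (hkn : 2 * k ≤ n) (r : ℝ) (U : Finset (ZMod n))
    {t i : ZMod n} (j : ZMod n) (hti : t ∈ positions k i) :
    (violating k r U t i j).card
      ≤ ballSize k r * (admissible k r (insert t U \ positions k i)).card := by
  classical
  rw [ballSize, ← card_product]
  refine card_le_card_of_injOn
    (fun x => (disagreement k i j x, fun v => if v ∈ positions k i then false else x v)) ?_ ?_
  · intro x hx
    simp only [violating, coe_filter, mem_univ, true_and, Set.mem_ofPred_eq] at hx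
    obtain ⟨⟨hsupp, hgood⟩, -, -, hbad⟩ := hx
    simp only [coe_product, Set.mem_prod, mem_coe, mem_filter, mem_univ, true_and,
      mem_admissible]
    refine ⟨hbad, fun v hv => ?_, fun a b hab ha hb => ?_⟩
    · split_ifs with h
      · rfl
      · exact hsupp v fun hv' => hv (mem_sdiff.2 ⟨hv', h⟩)
    · have hU : insert t U \ positions k i ⊆ U := by
        intro v hv
        obtain ⟨h1, h2⟩ := mem_sdiff.1 hv
        rcases mem_insert.1 h1 with rfl | h
        · exact absurd hti h2
        · exact h
      rw [disagreement_congr (y := x)]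
      · exact hgood a b hab (ha.trans hU) (hb.trans hU)
      · intro v hv
        exact if_neg (mem_sdiff.1 (ha hv)).2
      · intro v hv
        exact if_neg (mem_sdiff.1 (hb hv)).2
  · intro x hx y hy hxy
    simp only [violating, coe_filter, mem_univ, true_and, Set.mem_ofPred_eq] at hx
    simp only [Prod.mk.injEq] at hxy
    refine eq_of_disagreement_eq hkn hx.2.1 (fun v hv => ?_) hxy.1
    simpa [hv] using congrFun hxy.2 v

theorem two_mul_card_admissible_le [NeZero n] (k : ℕ) (r : ℝ) {U : Finset (ZMod n)}
    {t : ZMod n} (ht : t ∉ U) :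
    2 * (admissible k r U).card ≤ (admissible k r (insert t U)).card
      + ∑ p : Fin k × ZMod n, (violating k r U t (t - ((p.1 : ℕ) : ZMod n)) p.2).card := by
  classical
  have h1 : 2 * (admissible k r U).card = ((admissible k r U) ×ˢ (univ : Finset Bool)).card := by
    rw [card_product, card_univ, Fintype.card_bool, mul_comm]
  rw [h1]
  refine le_trans ?_ ((card_union_le (admissible k r (insert t U)) (univ.biUnion
    fun p : Fin k × ZMod n => violating k r U t (t - ((p.1 : ℕ) : ZMod n)) p.2)).trans
      (Nat.add_le_add_left card_biUnion_le _))
  refine card_le_card_of_injOn (fun p => Function.update p.1 t p.2) ?_ ?_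
  · rintro ⟨x, b⟩ hx
    simp only [coe_product, Set.mem_prod, mem_coe, mem_admissible] at hx
    obtain ⟨⟨hsupp, hgood⟩, -⟩ := hx
    set y := Function.update x t b with hy
    have hyx : ∀ v, v ≠ t → y v = x v := fun v hv => Function.update_of_ne hv _ _
    have hsupp' : ∀ v ∉ insert t U, y v = false := by
      intro v hv
      rw [mem_insert, not_or] at hv
      rw [hyx v hv.1, hsupp v hv.2]
    have hgood' : ∀ i j, i ≠ j → positions k i ⊆ U → positions k j ⊆ U →
        r < (disagreement k i j y).card := by
      intro i j hij hi hj
      rw [disagreement_congr (y := x) (fun v hv => hyx v fun h => ht (h ▸ hi hv))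
        (fun v hv => hyx v fun h => ht (h ▸ hj hv))]
      exact hgood i j hij hi hj
    have hmem : ∀ i j, i ≠ j → positions k i ⊆ insert t U →
        ((disagreement k i j y).card : ℝ) ≤ r → t ∈ positions k i →
        y ∈ univ.biUnion
          fun p : Fin k × ZMod n => violating k r U t (t - ((p.1 : ℕ) : ZMod n)) p.2 := by
      intro i j hij hi hbad hti
      obtain ⟨s, hs, hst⟩ := mem_positions.1 hti
      refine mem_biUnion.2 ⟨(⟨s, hs⟩, j), mem_univ _, ?_⟩
      have : t - (s : ZMod n) = i := by rw [← hst]; ring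
      simp only [this]
      exact mem_filter.2 ⟨mem_univ _, ⟨hsupp', hgood'⟩, hij, hi, hbad⟩
    simp only [mem_coe, mem_union]
    by_contra hcon
    rw [not_or] at hcon
    refine hcon.1 (mem_admissible.2 ⟨hsupp', fun i j hij hi hj => ?_⟩)
    by_contra! hbad
    have hti : t ∉ positions k i := fun h => hcon.2 (hmem i j hij hi hbad h)
    have htj : t ∉ positions k j := fun h =>
      hcon.2 (hmem j i hij.symm hj (by rwa [disagreement_comm]) h)
    exact hbad.not_gt (hgood' i j hij ((subset_insert_iff_of_notMem hti).1 hi)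
      ((subset_insert_iff_of_notMem htj).1 hj))
  · rintro ⟨x, b⟩ hx ⟨y, c⟩ hy hxy
    simp only [coe_product, Set.mem_prod, mem_coe, mem_admissible] at hx hy
    have hxt := hx.1.1 t ht
    have hyt := hy.1.1 t ht
    have hbc : b = c := by simpa using congrFun hxy t
    have : x = y := by
      funext v
      rcases eq_or_ne v t with rfl | hv
      · rw [hxt, hyt]
      · simpa [hv] using congrFun hxy v
    rw [this, hbc]

/-- The number of admissible sequences grows by a factor of at least `β` with each position. -/
theorem pow_mul_card_admissible_le [NeZero n] {k : ℕ} (hk : 0 < k) (hkn : 2 * k ≤ n) (r : ℝ)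
    {β : ℝ} (hβ : 0 < β) (hcount : (k * n * ballSize k r : ℝ) ≤ (2 - β) * β ^ (k - 1))
    (m : ℕ) : ∀ U : Finset (ZMod n), U.card = m → ∀ A ⊆ U,
      β ^ (U.card - A.card) * (admissible k r A).card ≤ (admissible k r U).card := by
  classical
  induction m with
  | zero =>
    intro U hU A hA
    rw [card_eq_zero] at hU
    subst hU
    rw [subset_empty.1 hA]
    simp
  | succ m ih =>
    intro U hU A hA
    rcases eq_or_ne A U with rfl | hne
    · simp
    obtain ⟨t, htU, htA⟩ := exists_of_ssubset (hA.ssubset_of_ne hne)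
    set V := U.erase t with hV
    have htV : t ∉ V := notMem_erase t U
    have hUV : insert t V = U := insert_erase htU
    have hVc : V.card = m := by rw [hV, card_erase_of_mem htU, hU]; rfl
    have hAV : A ⊆ V := fun v hv =>
      mem_erase.2 ⟨fun h => htA (h ▸ hv), hA hv⟩
    have hstep : β * (admissible k r V).card ≤ (admissible k r U).card := by
      have h2 := two_mul_card_admissible_le k r htV
      rw [hUV] at h2
      have h2' : (2 * (admissible k r V).card : ℝ) ≤ (admissible k r U).card
          + ∑ p : Fin k × ZMod n,
            ((violating k r V t (t - ((p.1 : ℕ) : ZMod n)) p.2).card : ℝ) := by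
        exact_mod_cast h2
      have hbound : ∀ p : Fin k × ZMod n,
          ((violating k r V t (t - ((p.1 : ℕ) : ZMod n)) p.2).card : ℝ)
            ≤ ballSize k r * ((admissible k r V).card / β ^ (k - 1)) := by
        rintro ⟨s, j⟩
        simp only
        set i := t - ((s : ℕ) : ZMod n) with hi
        have hti : t ∈ positions k i := mem_positions.2 ⟨s, s.2, by rw [hi]; ring⟩
        by_cases hiU : positions k i ⊆ U
        · have h3 := card_violating_le hkn r V j hti
          rw [hUV] at h3
          have hsub : U \ positions k i ⊆ V := by
            intro v hv
            obtain ⟨h1, h2⟩ := mem_sdiff.1 hv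
            exact mem_erase.2 ⟨fun h => h2 (h ▸ hti), h1⟩
          have h4 := ih V hVc _ hsub
          have hc : V.card - (U \ positions k i).card = k - 1 := by
            rw [card_sdiff_of_subset hiU, card_positions (by omega), hVc, hU]
            have := card_le_card hiU
            rw [card_positions (by omega), hU] at this
            omega
          rw [hc] at h4
          calc ((violating k r V t i j).card : ℝ)
              ≤ ballSize k r * (admissible k r (U \ positions k i)).card := by exact_mod_cast h3
            _ ≤ _ := by
              gcongr
              rw [le_div_iff₀ (by positivity), mul_comm]
              exact h4
        · have : violating k r V t i j = ∅ := by
            refine filter_eq_empty_iff.2 fun x _ hx => hiU ?_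
            rw [← hUV]
            exact hx.2.2.1
          rw [this]
          simp only [card_empty, Nat.cast_zero]
          positivity
      have hsum : ∑ p : Fin k × ZMod n,
          ((violating k r V t (t - ((p.1 : ℕ) : ZMod n)) p.2).card : ℝ)
            ≤ (2 - β) * (admissible k r V).card := by
        refine (sum_le_sum fun p _ => hbound p).trans ?_
        rw [sum_const, card_univ, Fintype.card_prod, Fintype.card_fin, ZMod.card, nsmul_eq_mul]
        push_cast
        calc (k * n * (ballSize k r * ((admissible k r V).card / β ^ (k - 1))) : ℝ)
            = (k * n * ballSize k r) * ((admissible k r V).card / β ^ (k - 1)) := by ring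
          _ ≤ ((2 - β) * β ^ (k - 1)) * ((admissible k r V).card / β ^ (k - 1)) := by gcongr
          _ = _ := by field_simp
      linarith
    have hexp : U.card - A.card = (V.card - A.card) + 1 := by
      have := card_le_card hAV
      omega
    calc β ^ (U.card - A.card) * ((admissible k r A).card : ℝ)
        = β * (β ^ (V.card - A.card) * (admissible k r A).card) := by rw [hexp]; ring
      _ ≤ β * (admissible k r V).card := by
        gcongr
        exact ih V hVc A hAV
      _ ≤ _ := hstep

theorem exists_separated_windows [NeZero n] {k : ℕ} (hk : 0 < k) (hkn : 2 * k ≤ n) (r : ℝ)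
    {β : ℝ} (hβ : 0 < β) (hcount : (k * n * ballSize k r : ℝ) ≤ (2 - β) * β ^ (k - 1)) :
    ∃ x : ZMod n → Bool, ∀ i j : ZMod n, i ≠ j →
      r < (hammingDist (win k x i) (win k x j) : ℝ) := by
  have h := pow_mul_card_admissible_le hk hkn r hβ hcount _ univ rfl ∅ (empty_subset _)
  have hempty : (fun _ => false) ∈ admissible k r (∅ : Finset (ZMod n)) := by
    refine mem_admissible.2 ⟨fun _ _ => rfl, fun i j _ hi _ => ?_⟩
    exact absurd (hi (add_natCast_mem_positions i ⟨0, hk⟩)) (notMem_empty _)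
  have hpos : 0 < ((admissible k r (∅ : Finset (ZMod n))).card : ℝ) :=
    Nat.cast_pos.2 (card_pos.2 ⟨_, hempty⟩)
  have huniv : 0 < ((admissible k r (univ : Finset (ZMod n))).card : ℝ) :=
    lt_of_lt_of_le (by positivity) h
  obtain ⟨x, hx⟩ := card_pos.1 (Nat.cast_pos.1 huniv)
  exact ⟨x, fun i j hij => (mem_admissible.1 hx).2 i j hij (subset_univ _) (subset_univ _)⟩

end CyclicWindow

theorem eventually_mul_two_rpow_le {a b c : ℝ} (hab : a < b) (hc : 0 < c) :
    ∀ᶠ k : ℕ in Filter.atTop, (k : ℝ) * (2 : ℝ) ^ (a * k) ≤ c * (2 : ℝ) ^ (b * k) := by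
  have hr : |(2 : ℝ) ^ (a - b)| < 1 := by
    rw [abs_of_pos (by positivity)]
    exact Real.rpow_lt_one_of_one_lt_of_neg one_lt_two (by linarith)
  filter_upwards [(tendsto_pow_const_mul_const_pow_of_abs_lt_one 1 hr).eventually_le_const hc]
    with k hk
  rw [pow_one, ← Real.rpow_mul_natCast two_pos.le] at hk
  have hsplit : (2 : ℝ) ^ (a * k) = (2 : ℝ) ^ ((a - b) * k) * (2 : ℝ) ^ (b * k) := by
    rw [← Real.rpow_add two_pos]
    ring_nf
  rw [hsplit, ← mul_assoc]
  gcongr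

theorem stmt1 (p R : ℝ) (hp0 : 0 ≤ p) (hp1 : p < 1 / 4) (hR0 : 0 < R)
    (hR1 : R < 1 - binEnt (2 * p)) :
    ∃ K : ℕ, ∀ k : ℕ, K ≤ k → ∃ n : ℕ,
      (2 : ℝ) ^ (R * k) ≤ n ∧
      ∃ x : ZMod n → Bool, ∀ m₁ m₂ : ZMod n, m₁ ≠ m₂ →
        2 * p * k < (hammingDist (win k x m₁) (win k x m₂) : ℝ) := by
  set h := binEnt (2 * p) with hh
  obtain ⟨b, hb0, hb1⟩ := exists_between (show R + h < 1 by linarith)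
  set β : ℝ := (2 : ℝ) ^ b with hβdef
  have hβ : 0 < β := by positivity
  have hβ2 : β < 2 := by
    simpa using Real.rpow_lt_rpow_of_exponent_lt one_lt_two hb1
  have hc : 0 < (2 - β) / (2 * β) := div_pos (by linarith) (by positivity)
  rw [← Filter.eventually_atTop]
  filter_upwards [eventually_mul_two_rpow_le hb0 hc,
    eventually_mul_two_rpow_le hR0 (show (0 : ℝ) < 1 / 2 by norm_num),
    Filter.eventually_gt_atTop 0] with k hk1 hk2 hk0
  have hk0' : (0 : ℝ) < k := Nat.cast_pos.2 hk0
  set N := (2 : ℝ) ^ (R * k) with hN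
  have hN1 : 1 ≤ N := Real.one_le_rpow one_le_two (by positivity)
  have hle : N ≤ ⌈N⌉₊ := Nat.le_ceil N
  refine ⟨⌈N⌉₊, hle, ?_⟩
  have : NeZero ⌈N⌉₊ := ⟨(Nat.ceil_pos.2 (by linarith)).ne'⟩
  have hkn : 2 * k ≤ ⌈N⌉₊ := by
    rw [zero_mul, Real.rpow_zero, mul_one] at hk2
    have : (2 * k : ℝ) ≤ ⌈N⌉₊ := by linarith
    exact_mod_cast this
  refine CyclicWindow.exists_separated_windows hk0 hkn _ hβ ?_
  have hball : (CyclicWindow.ballSize k (2 * p * k) : ℝ) ≤ (2 : ℝ) ^ (h * k) :=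
    card_small_subsets_le (2 * p) (by linarith) (by linarith) k
  have hceil : (⌈N⌉₊ : ℝ) ≤ 2 * N := by
    have := Nat.ceil_lt_add_one (show 0 ≤ N by linarith)
    linarith
  calc (k * ⌈N⌉₊ * CyclicWindow.ballSize k (2 * p * k) : ℝ)
      ≤ k * (2 * N) * (2 : ℝ) ^ (h * k) := by gcongr
    _ = 2 * (k * (2 : ℝ) ^ ((R + h) * k)) := by
      rw [add_mul, Real.rpow_add two_pos]
      ring
    _ ≤ 2 * ((2 - β) / (2 * β) * (2 : ℝ) ^ (b * k)) := by gcongr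
    _ = (2 - β) * β ^ (k - 1) := by
      have hpow : (2 : ℝ) ^ (b * k) = β ^ (k - 1) * β := by
        rw [← pow_succ, Nat.sub_add_cancel hk0, hβdef, ← Real.rpow_mul_natCast two_pos.le]
      rw [hpow]
      field_simp
end

section
/- Let a(z) = z^r + Σ_{i=0}^{r−1} a_i z^i be a primitive polynomial of degree r ≥ 1 over GF(2), let n = 2^r − 1, and let k satisfy r ≤ k ≤ n. Let x ∈ {0,1}^n be a sequence, not identically zero, satisfying the cyclic LFSR recursion x_{r+j} = Σ_{i=0}^{r−1} a_i x_{i+j} (mod 2) for all j ∈ {1,…,n} (indices cyclic modulo n). Then the n length-k cyclic windows φ(1),…,φ(n) of x are pairwise distinct, and the set {φ(m) : m ∈ {1,…,n}} ∪ {0^k} is closed under coordinatewise addition modulo 2 (i.e., it is a linear code over GF(2) of dimension r). -/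
/-- The monic polynomial `z^r + ∑_{i=0}^{r-1} a_i z^i` over GF(2). -/
noncomputable def lfsrPoly {r : ℕ} (a : Fin r → ZMod 2) : Polynomial (ZMod 2) :=
  Polynomial.X ^ r + ∑ i : Fin r, Polynomial.C (a i) * Polynomial.X ^ (i : ℕ)

/-- `a(z) = z^r + ∑_{i=0}^{r-1} a_i z^i` is primitive over GF(2): it is irreducible and
the residue class of `z` in `GF(2)[z]/(a(z))` has multiplicative order `2^r - 1`. -/
def IsPrimitivePoly {r : ℕ} (a : Fin r → ZMod 2) : Prop :=
  Irreducible (lfsrPoly a) ∧ orderOf (AdjoinRoot.root (lfsrPoly a)) = 2 ^ r - 1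

/-- The cyclic LFSR recursion `x_{r+j} = ∑_{i=0}^{r-1} a_i x_{i+j}` (mod 2),
for all `j`, indices cyclic modulo `n`. -/
def IsLFSR {n r : ℕ} (a : Fin r → ZMod 2) (x : ZMod n → ZMod 2) : Prop :=
  ∀ j : ZMod n, x (j + (r : ZMod n)) = ∑ i : Fin r, a i * x (j + ((i : ℕ) : ZMod n))

theorem shift_pow_apply {n : ℕ} (x : ZMod n → ZMod 2) (m : ℕ) (j : ZMod n) :
    ((LinearMap.funLeft (ZMod 2) (ZMod 2) (fun t : ZMod n => t + 1)) ^ m) x j = x (j + m) := by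
  induction m generalizing j with
  | zero => simp
  | succ m ih =>
    rw [pow_succ', Module.End.mul_apply, LinearMap.funLeft_apply, ih]
    push_cast
    congr 1
    ring

theorem IsLFSR.aeval_shift_eq_zero {n r : ℕ} {a : Fin r → ZMod 2} {x : ZMod n → ZMod 2}
    (h : IsLFSR a x) :
    Polynomial.aeval (LinearMap.funLeft (ZMod 2) (ZMod 2) (fun t : ZMod n => t + 1))
      (lfsrPoly a) x = 0 := by
  ext j
  simp only [lfsrPoly, map_add, map_sum, map_mul, map_pow, Polynomial.aeval_X,
    Polynomial.aeval_C, LinearMap.add_apply, LinearMap.sum_apply, Module.End.mul_apply,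
    Module.algebraMap_end_apply, Pi.add_apply, Finset.sum_apply, Pi.smul_apply,
    shift_pow_apply, smul_eq_mul, Pi.zero_apply, h j]
  exact CharTwo.add_self_eq_zero _

theorem IsLFSR.shift {n r : ℕ} {a : Fin r → ZMod 2} {x : ZMod n → ZMod 2}
    (h : IsLFSR a x) (m : ZMod n) : IsLFSR a (fun j => x (m + j)) := by
  intro j
  simpa only [add_assoc] using h (m + j)

theorem IsLFSR.add {n r : ℕ} {a : Fin r → ZMod 2} {x y : ZMod n → ZMod 2}
    (hx : IsLFSR a x) (hy : IsLFSR a y) : IsLFSR a (x + y) := by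
  intro j
  simp only [Pi.add_apply, hx j, hy j, mul_add, Finset.sum_add_distrib]

theorem isLFSR_zero {n r : ℕ} (a : Fin r → ZMod 2) : IsLFSR a (0 : ZMod n → ZMod 2) := by
  intro j
  simp

/-- A solution of the recursion is determined by its first `r` terms. -/
theorem IsLFSR.ext_win {n r k : ℕ} [NeZero n] {a : Fin r → ZMod 2} {x y : ZMod n → ZMod 2}
    (hx : IsLFSR a x) (hy : IsLFSR a y) (hrk : r ≤ k) (h : win k x 0 = win k y 0) : x = y := by
  have key : ∀ t : ℕ, x t = y t := by
    intro t
    induction t using Nat.strong_induction_on with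
    | _ t ih =>
      by_cases ht : t < r
      · simpa [win] using congrFun h ⟨t, ht.trans_le hrk⟩
      · obtain ⟨s, rfl⟩ := Nat.exists_eq_add_of_le' (not_lt.mp ht)
        push_cast
        rw [hx, hy]
        refine Finset.sum_congr rfl fun i _ => ?_
        have := ih (s + i) (by omega)
        push_cast at this
        rw [this]
  ext j
  simpa using key j.val

/-- For a primitive polynomial, the shifts of a nonzero solution are pairwise distinct. -/
theorem IsLFSR.shift_injective {n r : ℕ} [NeZero n] {a : Fin r → ZMod 2}
    {x : ZMod n → ZMod 2} (hn : n = 2 ^ r - 1) (ha : IsPrimitivePoly a) (hx : x ≠ 0)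
    (h : IsLFSR a x) : Function.Injective fun m j : ZMod n => x (m + j) := by
  intro m m' hm
  set q : Polynomial (ZMod 2) := Polynomial.X ^ m.val - Polynomial.X ^ m'.val with hq
  have hqx : Polynomial.aeval
      (LinearMap.funLeft (ZMod 2) (ZMod 2) (fun t : ZMod n => t + 1)) q x = 0 := by
    ext j
    have hj : x (m + j) = x (m' + j) := congrFun hm j
    simp [hq, shift_pow_apply, add_comm j, hj]
  have hdvd : lfsrPoly a ∣ q := by
    by_contra hnd
    obtain ⟨u, v, huv⟩ := (ha.1.coprime_iff_not_dvd).mpr hnd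
    apply hx
    have := congrArg (fun p => Polynomial.aeval
      (LinearMap.funLeft (ZMod 2) (ZMod 2) (fun t : ZMod n => t + 1)) p x) huv
    simpa [Module.End.mul_apply, hqx, h.aeval_shift_eq_zero] using this.symm
  have hroot : AdjoinRoot.root (lfsrPoly a) ^ m.val = AdjoinRoot.root (lfsrPoly a) ^ m'.val := by
    have := AdjoinRoot.mk_eq_zero.mpr hdvd
    simpa [hq, sub_eq_zero] using this
  have hord : orderOf (AdjoinRoot.root (lfsrPoly a)) = n := ha.2.trans hn.symm
  refine ZMod.val_injective n (pow_injOn_Iio_orderOf ?_ ?_ hroot)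
  · simpa [hord] using ZMod.val_lt m
  · simpa [hord] using ZMod.val_lt m'

theorem win_shift_zero {n k : ℕ} (x : ZMod n → ZMod 2) (m : ZMod n) :
    win k (fun j => x (m + j)) 0 = win k x m := by
  ext i
  simp [win]

theorem IsLFSR.win_injective {n r k : ℕ} [NeZero n] {a : Fin r → ZMod 2}
    {x : ZMod n → ZMod 2} (hn : n = 2 ^ r - 1) (ha : IsPrimitivePoly a) (hx : x ≠ 0)
    (h : IsLFSR a x) (hrk : r ≤ k) : Function.Injective fun m : ZMod n => win k x m := by
  intro m m' hm
  refine h.shift_injective hn ha hx ((h.shift m).ext_win (h.shift m') hrk ?_)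
  simpa only [win_shift_zero] using hm

theorem IsLFSR.win_ne_zero {n r k : ℕ} [NeZero n] {a : Fin r → ZMod 2}
    {x : ZMod n → ZMod 2} (hx : x ≠ 0) (h : IsLFSR a x) (hrk : r ≤ k) (m : ZMod n) :
    win k x m ≠ 0 := by
  intro h0
  have hs := (h.shift m).ext_win (isLFSR_zero a) hrk ((win_shift_zero x m).trans h0)
  apply hx
  ext j
  simpa using congrFun hs (j - m)

/-- For a primitive polynomial, every solution is zero or a shift of a given nonzero one. -/
theorem IsLFSR.eq_zero_or_eq_shift {n r : ℕ} [NeZero n] {a : Fin r → ZMod 2}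
    {x y : ZMod n → ZMod 2} (hn : n = 2 ^ r - 1) (ha : IsPrimitivePoly a) (hx : x ≠ 0)
    (h : IsLFSR a x) (hy : IsLFSR a y) : y = 0 ∨ ∃ m, y = fun j => x (m + j) := by
  let f : Option (ZMod n) → Fin r → ZMod 2 := fun o => o.elim 0 (win r x)
  have hf : Function.Injective f := by
    rintro (_ | m) (_ | m') hm
    · rfl
    · exact absurd hm.symm (h.win_ne_zero hx le_rfl m')
    · exact absurd hm (h.win_ne_zero hx le_rfl m)
    · exact congrArg some (h.win_injective hn ha hx le_rfl hm)
  have hcard : Fintype.card (Option (ZMod n)) = Fintype.card (Fin r → ZMod 2) := by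
    have := Nat.one_le_two_pow (n := r)
    simp only [Fintype.card_option, ZMod.card, Fintype.card_pi, Finset.prod_const,
      Finset.card_univ, Fintype.card_fin]
    omega
  obtain ⟨o, ho⟩ := ((Fintype.bijective_iff_injective_and_card f).mpr ⟨hf, hcard⟩).2 (win r y 0)
  cases o with
  | none => exact .inl (hy.ext_win (isLFSR_zero a) le_rfl ho.symm)
  | some m =>
    exact .inr ⟨m, hy.ext_win (h.shift m) le_rfl (ho.symm.trans (win_shift_zero x m).symm)⟩

theorem stmt2 (r n k : ℕ) (hr : 1 ≤ r) (hn : n = 2 ^ r - 1)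
    (hrk : r ≤ k) (hkn : k ≤ n)
    (a : Fin r → ZMod 2) (hprim : IsPrimitivePoly a)
    (x : ZMod n → ZMod 2) (hx : x ≠ 0) (hrec : IsLFSR a x) :
    Function.Injective (fun m : ZMod n => win k x m) ∧
    ∀ u v : Fin k → ZMod 2,
      ((∃ m, u = win k x m) ∨ u = 0) → ((∃ m, v = win k x m) ∨ v = 0) →
      ((∃ m, u + v = win k x m) ∨ u + v = 0) := by
  have : NeZero n := ⟨by omega⟩
  refine ⟨hrec.win_injective hn hprim hx hrk, fun u v hu hv => ?_⟩
  have extend : ∀ w : Fin k → ZMod 2, ((∃ m, w = win k x m) ∨ w = 0) →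
      ∃ y : ZMod n → ZMod 2, IsLFSR a y ∧ w = win k y 0 := by
    rintro w (⟨m, rfl⟩ | rfl)
    · exact ⟨_, hrec.shift m, (win_shift_zero x m).symm⟩
    · exact ⟨0, isLFSR_zero a, rfl⟩
  obtain ⟨y, hy, rfl⟩ := extend u hu
  obtain ⟨z, hz, rfl⟩ := extend v hv
  have hadd : win k y 0 + win k z 0 = win k (y + z) 0 := rfl
  rw [hadd]
  rcases hrec.eq_zero_or_eq_shift hn hprim hx (hy.add hz) with h0 | ⟨m, hm⟩
  · exact .inr (by rw [h0]; rfl)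
  · exact .inl ⟨m, by rw [hm, win_shift_zero]⟩
end

section
/- Let a(z) be a primitive polynomial of degree r ≥ 1 over GF(2), let n = 2^r − 1, and let x ∈ {0,1}^n be a sequence, not identically zero, satisfying the cyclic LFSR recursion with characteristic polynomial a(z) (i.e., x_{r+j} = Σ_{i=0}^{r−1} a_i x_{i+j} (mod 2) for all j ∈ {1,…,n}, indices cyclic modulo n, where a(z) = z^r + Σ_{i=0}^{r−1} a_i z^i). Then for every window length k with 1 ≤ k ≤ n and every phase m ∈ {1,…,n}, the Hamming weight wt(φ(m)) of the length-k cyclic window at phase m satisfies |wt(φ(m)) − k/2| ≤ √n · (log₂(n)/π + 1). -/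
lemma mul_pi_sub_div_pi_le_sin {x : ℝ} (h0 : 0 ≤ x) (hx : x ≤ Real.pi) :
    x * (Real.pi - x) / Real.pi ≤ Real.sin x := by
  have hpi := Real.pi_pos
  wlog hle : x ≤ Real.pi / 2 generalizing x
  · have := this (x := Real.pi - x) (by linarith) (by linarith) (by linarith)
    rw [Real.sin_pi_sub, sub_sub_cancel, mul_comm] at this
    exact this
  have hderiv (y : ℝ) : HasDerivAt (fun y => Real.sin y - y * (Real.pi - y) / Real.pi)
      (Real.cos y - (1 - 2 / Real.pi * y)) y := by
    have h := (Real.hasDerivAt_sin y).sub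
      (((hasDerivAt_id y).mul ((hasDerivAt_id y).const_sub Real.pi)).div_const Real.pi)
    refine h.congr_deriv ?_
    simp only [id]
    field_simp
    ring
  have hmono : MonotoneOn (fun y => Real.sin y - y * (Real.pi - y) / Real.pi)
      (Set.Icc 0 (Real.pi / 2)) := by
    refine monotoneOn_of_deriv_nonneg (convex_Icc _ _)
      (fun y _ => (hderiv y).continuousAt.continuousWithinAt)
      (fun y _ => (hderiv y).differentiableAt.differentiableWithinAt) fun y hy => ?_
    rw [interior_Icc] at hy
    rw [(hderiv y).deriv, sub_nonneg]
    exact Real.one_sub_mul_le_cos hy.1.le hy.2.le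
  have := hmono ⟨le_rfl, by positivity⟩ ⟨h0, hle⟩ h0
  simpa using this

lemma inv_sin_pi_mul_div_le {n v : ℕ} (hv : 1 ≤ v) (hvn : v < n) :
    (Real.sin (Real.pi * v / n))⁻¹ ≤
      n / Real.pi * ((v : ℝ)⁻¹ + ((n - v : ℕ) : ℝ)⁻¹) := by
  have hpi := Real.pi_pos
  have hv0 : (0 : ℝ) < v := by exact_mod_cast hv
  have hvn' : (v : ℝ) < n := by exact_mod_cast hvn
  have hn0 : (0 : ℝ) < n := hv0.trans hvn'
  have hsub : (0 : ℝ) < n - v := sub_pos.2 hvn'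
  have hle : Real.pi * v / n ≤ Real.pi := by
    rw [div_le_iff₀ hn0]
    exact mul_le_mul_of_nonneg_left hvn'.le hpi.le
  have h := mul_pi_sub_div_pi_le_sin (x := Real.pi * v / n) (by positivity) hle
  have heq : Real.pi * v / n * (Real.pi - Real.pi * v / n) / Real.pi =
      (n / Real.pi * ((v : ℝ)⁻¹ + ((n - v : ℕ) : ℝ)⁻¹))⁻¹ := by
    rw [Nat.cast_sub hvn.le]
    field_simp
    ring
  rw [heq] at h
  rw [Nat.cast_sub hvn.le] at h ⊢
  exact inv_le_of_inv_le₀ (by positivity) h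

lemma sum_Ico_inv_sin_le (n : ℕ) :
    ∑ v ∈ Finset.Ico 1 n, (Real.sin (Real.pi * v / n))⁻¹ ≤
      2 * n / Real.pi * (1 + Real.log n) := by
  rcases Nat.eq_zero_or_pos n with rfl | hn
  · simp
  have hpi := Real.pi_pos
  have hharm : ∑ v ∈ Finset.Ico 1 n, ((v : ℝ))⁻¹ ≤ 1 + Real.log n := by
    calc ∑ v ∈ Finset.Ico 1 n, ((v : ℝ))⁻¹ ≤ ∑ v ∈ Finset.Icc 1 n, ((v : ℝ))⁻¹ :=
          Finset.sum_le_sum_of_subset_of_nonneg Finset.Ico_subset_Icc_self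
            fun _ _ _ => by positivity
      _ = ((harmonic n : ℚ) : ℝ) := by rw [harmonic_eq_sum_Icc]; push_cast; rfl
      _ ≤ _ := harmonic_le_one_add_log n
  have hrefl : ∑ v ∈ Finset.Ico 1 n, (((n - v : ℕ) : ℝ))⁻¹ =
      ∑ v ∈ Finset.Ico 1 n, ((v : ℝ))⁻¹ := by
    refine Finset.sum_nbij' (fun v => n - v) (fun v => n - v) ?_ ?_ ?_ ?_ ?_ <;>
      simp only [Finset.mem_Ico] <;> intros <;> first | omega | trivial
  calc ∑ v ∈ Finset.Ico 1 n, (Real.sin (Real.pi * v / n))⁻¹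
      ≤ ∑ v ∈ Finset.Ico 1 n, n / Real.pi * ((v : ℝ)⁻¹ + ((n - v : ℕ) : ℝ)⁻¹) :=
        Finset.sum_le_sum fun v hv => by
          rw [Finset.mem_Ico] at hv
          exact inv_sin_pi_mul_div_le hv.1 hv.2
    _ = 2 * n / Real.pi * ∑ v ∈ Finset.Ico 1 n, ((v : ℝ))⁻¹ := by
        rw [← Finset.mul_sum, Finset.sum_add_distrib, hrefl]
        ring
    _ ≤ _ := mul_le_mul_of_nonneg_left hharm (by positivity)

lemma ZMod.sum_comp_val {M : Type*} [AddCommMonoid M] {n : ℕ} [NeZero n] (f : ℕ → M) :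
    ∑ t ∈ Finset.univ.erase (0 : ZMod n), f t.val = ∑ v ∈ Finset.Ico 1 n, f v := by
  refine Finset.sum_nbij ZMod.val ?_ (ZMod.val_injective n).injOn ?_ fun _ _ => rfl
  · intro t ht
    rw [Finset.mem_Ico]
    exact ⟨Nat.one_le_iff_ne_zero.2 ((ZMod.val_ne_zero t).2 (Finset.ne_of_mem_erase ht)),
      t.val_lt⟩
  · intro v hv
    simp only [Finset.coe_Ico, Set.mem_Ico] at hv
    have hval : ((v : ZMod n)).val = v := ZMod.val_natCast_of_lt hv.2
    refine ⟨v, ?_, hval⟩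
    simp only [Finset.coe_erase, Finset.coe_univ, Set.mem_sdiff, Set.mem_univ, true_and,
      Set.mem_singleton_iff]
    intro h
    rw [h, ZMod.val_zero] at hval
    omega

lemma norm_stdAddChar_sub_one {n : ℕ} [NeZero n] (t : ZMod n) :
    ‖ZMod.stdAddChar t - 1‖ = 2 * Real.sin (Real.pi * t.val / n) := by
  have hn0 : (0 : ℝ) < n := by exact_mod_cast NeZero.pos n
  have hexp : (ZMod.stdAddChar t : ℂ) =
      Complex.exp (Complex.I * ((2 * Real.pi * t.val / n : ℝ) : ℂ)) := by
    rw [ZMod.stdAddChar_apply, ZMod.toCircle_apply]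
    push_cast
    ring_nf
  have hle : Real.pi * t.val / n ≤ Real.pi := by
    rw [div_le_iff₀ hn0]
    exact mul_le_mul_of_nonneg_left (by exact_mod_cast t.val_lt.le) Real.pi_pos.le
  rw [hexp, Complex.norm_exp_I_mul_ofReal_sub_one,
    show 2 * Real.pi * t.val / n / 2 = Real.pi * t.val / n by ring, Real.norm_eq_abs, abs_of_nonneg]
  exact mul_nonneg zero_le_two (Real.sin_nonneg_of_nonneg_of_le_pi (by positivity) hle)

lemma norm_sum_stdAddChar_le {n : ℕ} [NeZero n] {t : ZMod n} (ht : t ≠ 0) (k : ℕ) (m : ZMod n) :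
    ‖∑ i ∈ Finset.range k, (ZMod.stdAddChar (t * (m + (i : ZMod n))) : ℂ)‖ ≤
      (Real.sin (Real.pi * t.val / n))⁻¹ := by
  set z : ℂ := ZMod.stdAddChar t with hz
  have hz1 : z ≠ 1 := fun h => ht <| ZMod.injective_stdAddChar <| by
    rw [AddChar.map_zero_eq_one, ← h]
  have hsum : ∑ i ∈ Finset.range k, (ZMod.stdAddChar (t * (m + (i : ZMod n))) : ℂ) =
      ZMod.stdAddChar (t * m) * ((z ^ k - 1) / (z - 1)) := by
    rw [← geom_sum_eq hz1, Finset.mul_sum]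
    refine Finset.sum_congr rfl fun i _ => ?_
    rw [mul_add, AddChar.map_add_eq_mul, mul_comm t (i : ZMod n), ← nsmul_eq_mul,
      AddChar.map_nsmul_eq_pow]
  have hnum : ‖z ^ k - 1‖ ≤ 2 := by
    refine (norm_sub_le _ _).trans ?_
    rw [norm_pow, hz, AddChar.norm_apply]
    norm_num
  rw [hsum, norm_mul, AddChar.norm_apply, one_mul, norm_div, hz, norm_stdAddChar_sub_one, ← hz]
  have hpos : 0 < 2 * Real.sin (Real.pi * t.val / n) := by
    rw [← norm_stdAddChar_sub_one]
    exact norm_pos_iff.2 (sub_ne_zero.2 hz1)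
  calc _ ≤ 2 / (2 * Real.sin (Real.pi * t.val / n)) := by gcongr
    _ = _ := by rw [← div_div, div_self two_ne_zero, one_div]

open scoped ZMod in
lemma norm_window_sum_le {n : ℕ} [NeZero n] (s : ZMod n → ℂ) {A B : ℝ} (hA : ‖𝓕 s 0‖ ≤ A)
    (hB : ∀ t ≠ 0, ‖𝓕 s t‖ ≤ B) (hB0 : 0 ≤ B) (k : ℕ) (m : ZMod n) :
    ‖∑ i ∈ Finset.range k, s (m + (i : ZMod n))‖ ≤
      k / n * A + B * (2 / Real.pi * (1 + Real.log n)) := by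
  have hn0 : (0 : ℝ) < n := by exact_mod_cast NeZero.pos n
  have hinv (j : ZMod n) : s j = (n : ℂ)⁻¹ * ∑ t, ZMod.stdAddChar (t * j) * 𝓕 s t := by
    conv_lhs => rw [← ZMod.dft.symm_apply_apply s]
    rw [ZMod.invDFT_apply]
    simp only [smul_eq_mul]
  have hsum : ∑ i ∈ Finset.range k, s (m + (i : ZMod n)) =
      (n : ℂ)⁻¹ * ∑ t, (∑ i ∈ Finset.range k,
        (ZMod.stdAddChar (t * (m + (i : ZMod n))) : ℂ)) * 𝓕 s t := by
    simp only [hinv (m + _), ← Finset.mul_sum, Finset.sum_mul]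
    rw [Finset.sum_comm]
  rw [hsum, ← Finset.add_sum_erase _ _ (Finset.mem_univ (0 : ZMod n)), norm_mul, norm_inv,
    Complex.norm_natCast]
  have hzero : ‖(∑ i ∈ Finset.range k,
      (ZMod.stdAddChar ((0 : ZMod n) * (m + (i : ZMod n))) : ℂ)) * 𝓕 s 0‖ ≤ k * A := by
    simp only [zero_mul, AddChar.map_zero_eq_one, Finset.sum_const, Finset.card_range,
      nsmul_eq_mul, mul_one, norm_mul, Complex.norm_natCast]
    gcongr
  have hne : ‖∑ t ∈ Finset.univ.erase (0 : ZMod n), (∑ i ∈ Finset.range k,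
      (ZMod.stdAddChar (t * (m + (i : ZMod n))) : ℂ)) * 𝓕 s t‖ ≤
      2 * n / Real.pi * (1 + Real.log n) * B := by
    refine (norm_sum_le _ _).trans ?_
    refine le_trans ?_ (mul_le_mul_of_nonneg_right (sum_Ico_inv_sin_le n) hB0)
    rw [← ZMod.sum_comp_val (fun v : ℕ => (Real.sin (Real.pi * v / n))⁻¹), Finset.sum_mul]
    refine Finset.sum_le_sum fun t ht => ?_
    have ht0 := Finset.ne_of_mem_erase ht
    have h := norm_sum_stdAddChar_le ht0 k m
    rw [norm_mul]
    exact mul_le_mul h (hB t ht0) (norm_nonneg _) ((norm_nonneg _).trans h)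
  calc _ ≤ (n : ℝ)⁻¹ * (k * A + 2 * n / Real.pi * (1 + Real.log n) * B) := by
        gcongr
        exact (norm_add_le _ _).trans (add_le_add hzero hne)
    _ = _ := by
        field_simp

open scoped ZMod ComplexConjugate in
lemma normSq_dft_of_autocorrelation {n : ℕ} [NeZero n] (s : ZMod n → ℂ)
    (hs : ∀ τ, ∑ l, s (l + τ) * conj (s l) = if τ = 0 then (n : ℂ) else -1) (t : ZMod n) :
    ‖𝓕 s t‖ ^ 2 = if t = 0 then 1 else (n : ℝ) + 1 := by
  have hchar (u : ZMod n) : ∑ τ : ZMod n, (ZMod.stdAddChar (τ * u) : ℂ) =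
      if u = 0 then (n : ℂ) else 0 := by
    rw [AddChar.sum_mulShift u (ZMod.isPrimitive_stdAddChar n), ZMod.card]
    split_ifs <;> simp
  have hexpand : 𝓕 s t * conj (𝓕 s t) =
      ∑ τ, ZMod.stdAddChar (τ * -t) * ∑ l, s (l + τ) * conj (s l) := by
    simp only [ZMod.dft_apply, smul_eq_mul, map_sum, map_mul, Finset.mul_sum, Finset.sum_mul]
    conv_rhs => rw [Finset.sum_comm]
    refine Finset.sum_congr rfl fun l _ => ?_
    rw [← Equiv.sum_comp (Equiv.addLeft l)]
    refine Finset.sum_congr rfl fun τ _ => ?_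
    rw [Equiv.coe_addLeft, ← AddChar.map_neg_eq_conj, neg_neg,
      show τ * -t = -((l + τ) * t) + l * t by ring, AddChar.map_add_eq_mul]
    ring
  have hval : 𝓕 s t * conj (𝓕 s t) = if t = 0 then 1 else (n : ℂ) + 1 := by
    have hite (τ : ZMod n) : (if τ = 0 then (n : ℂ) else -1) =
        (if τ = 0 then (n : ℂ) + 1 else 0) - 1 := by
      split_ifs <;> ring
    simp only [hexpand, hs, hite, mul_sub, mul_one, Finset.sum_sub_distrib, hchar, mul_ite,
      mul_zero, Finset.sum_ite_eq', Finset.mem_univ, if_true, zero_mul, AddChar.map_zero_eq_one,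
      one_mul, neg_eq_zero]
    split_ifs <;> ring
  rw [Complex.mul_conj, Complex.normSq_eq_norm_sq] at hval
  split_ifs at hval ⊢ <;> exact_mod_cast hval

section PowerSums

variable {F : Type*} [Field F] {n : ℕ} [NeZero n] {α : F}

lemma ZMod.pow_val_add (hα : α ^ n = 1) (i j : ZMod n) :
    α ^ (i + j).val = α ^ i.val * α ^ j.val := by
  rw [ZMod.val_add, ← pow_add, ← pow_eq_pow_mod _ hα]

open scoped ComplexConjugate in
lemma autocorrelation_addChar_pow [Fintype F] (hα : orderOf α = n) (hcard : Fintype.card F = n + 1)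
    {ψ : AddChar F ℂ} (hψ : ψ.IsPrimitive) (τ : ZMod n) :
    ∑ l : ZMod n, ψ (α ^ (l + τ).val) * conj (ψ (α ^ l.val)) =
      if τ = 0 then (n : ℂ) else -1 := by
  classical
  have hpow : α ^ n = 1 := hα ▸ pow_orderOf_eq_one α
  have hinj : Function.Injective fun l : ZMod n => α ^ l.val := fun i j hij =>
    ZMod.val_injective n <| pow_injOn_Iio_orderOf
      (by simpa [hα] using i.val_lt) (by simpa [hα] using j.val_lt) hij
  have hα0 : α ≠ 0 := by
    rintro rfl
    simp [zero_pow (NeZero.ne n)] at hpow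
  have himage : Finset.univ.image (fun l : ZMod n => α ^ l.val) = Finset.univ.erase 0 := by
    refine Finset.eq_of_subset_of_card_le ?_ ?_
    · intro y hy
      obtain ⟨l, -, rfl⟩ := Finset.mem_image.1 hy
      exact Finset.mem_erase.2 ⟨pow_ne_zero _ hα0, Finset.mem_univ _⟩
    · rw [Finset.card_image_of_injective _ hinj, Finset.card_erase_of_mem (Finset.mem_univ _),
        Finset.card_univ, Finset.card_univ, hcard, ZMod.card, Nat.add_sub_cancel]
  have hsum (c : F) : ∑ l : ZMod n, ψ (α ^ l.val * c) = (∑ y, ψ (y * c)) - 1 := by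
    rw [← Finset.add_sum_erase _ _ (Finset.mem_univ (0 : F)), ← himage,
      Finset.sum_image hinj.injOn, zero_mul, AddChar.map_zero_eq_one, add_sub_cancel_left]
  have hterm (l : ZMod n) : ψ (α ^ (l + τ).val) * conj (ψ (α ^ l.val)) =
      ψ (α ^ l.val * (α ^ τ.val - 1)) := by
    rw [← AddChar.map_neg_eq_conj, ← AddChar.map_add_eq_mul, ZMod.pow_val_add hpow]
    ring_nf
  have hzero : α ^ τ.val - 1 = 0 ↔ τ = 0 := by
    rw [sub_eq_zero, ← pow_zero α, ← ZMod.val_zero (n := n)]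
    exact hinj.eq_iff
  simp only [hterm, hsum, AddChar.sum_mulShift _ hψ, hzero, hcard]
  split_ifs <;> simp

end PowerSums

lemma lfsrPoly_eq {r : ℕ} (a : Fin r → ZMod 2) :
    (lfsrPoly a).natDegree = r ∧ (lfsrPoly a).Monic := by
  have hdeg : (∑ i : Fin r, Polynomial.C (a i) * Polynomial.X ^ (i : ℕ)).degree <
      ((r : ℕ) : WithBot ℕ) := by
    refine (Polynomial.degree_sum_le _ _).trans_lt ?_
    refine (Finset.sup_lt_iff (WithBot.bot_lt_coe r)).2 fun i _ => ?_
    exact (Polynomial.degree_C_mul_X_pow_le _ _).trans_lt (Nat.cast_lt.2 i.2)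
  refine ⟨?_, Polynomial.monic_X_pow_add hdeg⟩
  refine Polynomial.natDegree_eq_of_degree_eq_some ?_
  rw [lfsrPoly, Polynomial.degree_add_eq_left_of_degree_lt, Polynomial.degree_X_pow]
  rwa [Polynomial.degree_X_pow]

lemma root_pow_lfsrPoly {r : ℕ} (a : Fin r → ZMod 2) :
    AdjoinRoot.root (lfsrPoly a) ^ r =
      ∑ i : Fin r, a i • AdjoinRoot.root (lfsrPoly a) ^ (i : ℕ) := by
  have h : AdjoinRoot.mk (lfsrPoly a) (lfsrPoly a) = 0 := AdjoinRoot.mk_self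
  conv_lhs at h => arg 2; rw [lfsrPoly]
  simp only [map_add, map_sum, map_mul, map_pow, AdjoinRoot.mk_X, AdjoinRoot.mk_C] at h
  have hneg (y : AdjoinRoot (lfsrPoly a)) : -y = y := by
    have h2 : (2 : ZMod 2) • y = 0 := by rw [show (2 : ZMod 2) = 0 from rfl, zero_smul]
    rw [neg_eq_iff_add_eq_zero, ← two_smul (ZMod 2), h2]
  rw [eq_neg_of_add_eq_zero_left h, hneg]
  exact Finset.sum_congr rfl fun i _ => by
    rw [Algebra.smul_def, AdjoinRoot.algebraMap_eq]

/-- A cyclic LFSR sequence is a linear functional applied to the powers of the root of its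
characteristic polynomial. -/
lemma IsLFSR.exists_linearMap {r n : ℕ} {a : Fin r → ZMod 2} {x : ZMod n → ZMod 2}
    (hx : IsLFSR a x) : ∃ f : AdjoinRoot (lfsrPoly a) →ₗ[ZMod 2] ZMod 2,
      ∀ j : ℕ, f (AdjoinRoot.root (lfsrPoly a) ^ j) = x j := by
  obtain ⟨hdeg, hmonic⟩ := lfsrPoly_eq a
  set pb := AdjoinRoot.powerBasis' hmonic with hpb
  refine ⟨pb.basis.constr (ZMod 2) fun i => x ((i : ℕ) : ZMod n), fun j => ?_⟩
  induction j using Nat.strong_induction_on with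
  | _ j ih =>
    rcases lt_or_ge j r with hj | hj
    · have hj' : j < pb.dim := by rwa [hpb, AdjoinRoot.powerBasis'_dim, hdeg]
      have h := pb.basis_eq_pow ⟨j, hj'⟩
      rw [show pb.gen = AdjoinRoot.root (lfsrPoly a) from AdjoinRoot.powerBasis'_gen hmonic] at h
      rw [← h, Module.Basis.constr_basis]
    · obtain ⟨d, rfl⟩ := Nat.exists_eq_add_of_le' hj
      rw [pow_add, root_pow_lfsrPoly, Finset.mul_sum, map_sum, Nat.cast_add, hx]
      refine Finset.sum_congr rfl fun i _ => ?_
      rw [mul_smul_comm, ← pow_add, map_smul, ih _ (by omega), Nat.cast_add, smul_eq_mul]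

open scoped ComplexConjugate in
lemma IsLFSR.exists_autocorrelation {r n : ℕ} [NeZero n] {a : Fin r → ZMod 2}
    {x : ZMod n → ZMod 2} (hrec : IsLFSR a x) (hprim : IsPrimitivePoly a) (hn : n = 2 ^ r - 1)
    (hx : x ≠ 0) :
    ∃ s : ZMod n → ℂ, (∀ j, s j = ZMod.stdAddChar (x j)) ∧
      ∀ τ, ∑ l, s (l + τ) * conj (s l) = if τ = 0 then (n : ℂ) else -1 := by
  obtain ⟨hirr, hord⟩ := hprim
  rw [← hn] at hord
  have : Fact (Irreducible (lfsrPoly a)) := ⟨hirr⟩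
  obtain ⟨hdeg, hmonic⟩ := lfsrPoly_eq a
  obtain ⟨f, hf⟩ := hrec.exists_linearMap
  have : Module.Finite (ZMod 2) (AdjoinRoot (lfsrPoly a)) := hmonic.finite_adjoinRoot
  have : Finite (AdjoinRoot (lfsrPoly a)) := Module.finite_of_finite (ZMod 2)
  have : Fintype (AdjoinRoot (lfsrPoly a)) := Fintype.ofFinite _
  have hcard : Fintype.card (AdjoinRoot (lfsrPoly a)) = n + 1 := by
    rw [← Nat.card_eq_fintype_card, Module.natCard_eq_pow_finrank (K := ZMod 2), Nat.card_zmod,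
      (AdjoinRoot.powerBasis' hmonic).finrank, AdjoinRoot.powerBasis'_dim, hdeg, hn,
      Nat.sub_add_cancel Nat.one_le_two_pow]
  have hval (j : ZMod n) : f (AdjoinRoot.root (lfsrPoly a) ^ j.val) = x j := by
    rw [hf, ZMod.natCast_zmod_val]
  let ψ : AddChar (AdjoinRoot (lfsrPoly a)) ℂ :=
    (ZMod.stdAddChar (N := 2)).compAddMonoidHom f.toAddMonoidHom
  have hψ (y) : ψ y = ZMod.stdAddChar (f y) := rfl
  have hψ1 : ψ ≠ 1 := fun h => hx <| funext fun j => by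
    refine ZMod.injective_stdAddChar ?_
    rw [← hval, ← hψ, h, AddChar.one_apply, Pi.zero_apply, AddChar.map_zero_eq_one]
  exact ⟨fun j => ψ (AdjoinRoot.root (lfsrPoly a) ^ j.val), fun j => (hψ _).trans (by rw [hval]),
    autocorrelation_addChar_pow hord hcard (AddChar.IsPrimitive.of_ne_one hψ1)⟩

lemma sum_stdAddChar_eq_sub_hammingNorm {k : ℕ} (w : Fin k → ZMod 2) :
    ∑ i, (ZMod.stdAddChar (w i) : ℂ) = ((k - 2 * hammingNorm w : ℝ) : ℂ) := by
  have hne : (ZMod.stdAddChar (1 : ZMod 2) : ℂ) = -1 := by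
    have h := ZMod.stdAddChar_coe (N := 2) 1
    rw [Int.cast_one] at h
    rw [h, ← Complex.exp_pi_mul_I]
    congr 1
    push_cast
    ring
  have hval (b : ZMod 2) : (ZMod.stdAddChar b : ℂ) = 1 - 2 * if b ≠ 0 then 1 else 0 := by
    fin_cases b
    · change (ZMod.stdAddChar (0 : ZMod 2) : ℂ) = 1 - 2 * if (0 : ZMod 2) ≠ 0 then 1 else 0
      simp
    · change (ZMod.stdAddChar (1 : ZMod 2) : ℂ) = 1 - 2 * if (1 : ZMod 2) ≠ 0 then 1 else 0
      rw [hne, if_pos one_ne_zero]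
      norm_num
  simp only [hval, Finset.sum_sub_distrib, ← Finset.mul_sum, Finset.sum_boole, hammingNorm]
  simp

lemma one_add_sqrt_mul_log_le {n : ℕ} (hn : 3 ≤ n) :
    1 + Real.sqrt (n + 1) * (2 / Real.pi * (1 + Real.log n)) ≤
      2 * (Real.sqrt n * (Real.logb 2 n / Real.pi + 1)) := by
  have hpi := Real.pi_gt_three
  have hn3 : (3 : ℝ) ≤ n := by exact_mod_cast hn
  have hL : 0 ≤ Real.log n := Real.log_nonneg (by linarith)
  have hs1 : 1.7 ≤ Real.sqrt n := Real.le_sqrt_of_sq_le (by norm_num; linarith)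
  have hs2 : Real.sqrt (n + 1) ≤ 1.16 * Real.sqrt n := by
    rw [Real.sqrt_le_left (by positivity), mul_pow, Real.sq_sqrt (by linarith)]
    norm_num
    linarith
  have hlog : 1.4 * Real.log n ≤ Real.logb 2 n := by
    rw [Real.logb, le_div_iff₀ (Real.log_pos one_lt_two)]
    nlinarith [Real.log_two_lt_d9]
  have hq : (Real.pi)⁻¹ ≤ 1 / 3 := by
    rw [one_div]
    exact inv_anti₀ (by norm_num) hpi.le
  have hq0 : 0 < (Real.pi)⁻¹ := by positivity
  have h1 : Real.sqrt (n + 1) * (2 / Real.pi * (1 + Real.log n)) ≤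
      1.16 * Real.sqrt n * (2 / Real.pi * (1 + Real.log n)) := by
    gcongr
  have h2 : 2 * (Real.sqrt n * (1.4 * Real.log n / Real.pi + 1)) ≤
      2 * (Real.sqrt n * (Real.logb 2 n / Real.pi + 1)) := by
    gcongr
  have h3 : 1 ≤ Real.sqrt n * (1.2 : ℝ) := by linarith
  have h4 : 1.2 + 1.16 * (2 / Real.pi * (1 + Real.log n)) ≤
      2 * (1.4 * Real.log n / Real.pi + 1) := by
    rw [div_eq_mul_inv, div_eq_mul_inv]
    nlinarith [mul_nonneg hL hq0.le]
  nlinarith [mul_le_mul_of_nonneg_left h4 (Real.sqrt_nonneg n)]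

theorem stmt5 (r n : ℕ) (hr : 1 ≤ r) (hn : n = 2 ^ r - 1)
    (a : Fin r → ZMod 2) (hprim : IsPrimitivePoly a)
    (x : ZMod n → ZMod 2) (hx : x ≠ 0) (hrec : IsLFSR a x)
    (k : ℕ) (hk1 : 1 ≤ k) (hkn : k ≤ n) (m : ZMod n) :
    |(hammingNorm (win k x m) : ℝ) - (k : ℝ) / 2| ≤
      Real.sqrt n * (Real.logb 2 n / Real.pi + 1) := by
  rcases eq_or_lt_of_le hr with rfl | hr2
  · obtain rfl : n = 1 := by simpa using hn
    obtain rfl : k = 1 := le_antisymm hkn hk1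
    have h := hammingNorm_le_card_fintype (x := win 1 x m)
    simp only [Fintype.card_fin] at h
    have h' : (hammingNorm (win 1 x m) : ℝ) ≤ 1 := by exact_mod_cast h
    have h0 : (0 : ℝ) ≤ hammingNorm (win 1 x m) := Nat.cast_nonneg _
    norm_num
    rw [abs_le]
    constructor <;> linarith
  have hpow : 2 ^ 2 ≤ 2 ^ r := Nat.pow_le_pow_right (by norm_num) hr2
  have hn3 : 3 ≤ n := by omega
  have : NeZero n := ⟨by omega⟩
  obtain ⟨s, hs, hauto⟩ := hrec.exists_autocorrelation hprim hn hx
  have hnorm := normSq_dft_of_autocorrelation s hauto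
  have hzero : ‖ZMod.dft s 0‖ ≤ 1 := by
    have h := hnorm 0
    rw [if_pos rfl] at h
    exact (pow_le_one_iff_of_nonneg (norm_nonneg _) two_ne_zero).1 h.le
  have hne (t : ZMod n) (ht : t ≠ 0) : ‖ZMod.dft s t‖ ≤ Real.sqrt (n + 1) := by
    have h := hnorm t
    rw [if_neg ht] at h
    exact Real.le_sqrt_of_sq_le h.le
  have hwin := norm_window_sum_le s hzero hne (Real.sqrt_nonneg _) k m
  have hsum : ∑ i ∈ Finset.range k, s (m + (i : ZMod n)) =
      ((k - 2 * hammingNorm (win k x m) : ℝ) : ℂ) := by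
    rw [← sum_stdAddChar_eq_sub_hammingNorm, Finset.sum_range]
    simp only [hs, win]
  rw [hsum, Complex.norm_real, Real.norm_eq_abs, mul_one] at hwin
  have hkn' : (k : ℝ) / n ≤ 1 := div_le_one_of_le₀ (by exact_mod_cast hkn) (Nat.cast_nonneg _)
  have hfinal := one_add_sqrt_mul_log_le hn3
  have habs : |(k : ℝ) - 2 * hammingNorm (win k x m)| =
      2 * |(hammingNorm (win k x m) : ℝ) - k / 2| := by
    rw [← abs_neg, ← abs_two, ← abs_mul, abs_two]
    ring_nf
  linarith
end

section
/- Let r ≥ 1 and k > r be integers, let a_0,…,a_r ∈ {0,1} with a_0 = a_r = 1, and let c be the number of indices i with a_i = 1. Let H be the (k−r)×k matrix over GF(2) whose j-th row (j = 1,…,k−r) has entry a_{i−j} in column i for j ≤ i ≤ j + r and 0 elsewhere (i.e., the rows of H are the k−r consecutive shifts of the vector (a_0,…,a_r)). Then for every integer i ≥ 1 with i·c² ≤ k − r, the number of distinct vectors of Hamming weight exactly i·c in the GF(2)-row span of H is at least (1/i!)·∏_{j=0}^{i−1} (k − r − j·c²). -/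
open Finset in
/-- The `m`-element independent sets of a symmetric conflict relation. -/
noncomputable def independentSets {α : Type*} [Fintype α] (R : α → α → Prop) (m : ℕ) :
    Finset (Finset α) := by
  classical
  exact {s ∈ powersetCard m univ | (s : Set α).Pairwise fun x y => ¬ R x y}

theorem mem_independentSets {α : Type*} [Fintype α] {R : α → α → Prop} {m : ℕ} {s : Finset α} :
    s ∈ independentSets R m ↔ s.card = m ∧ (s : Set α).Pairwise fun x y => ¬ R x y := by
  simp [independentSets, Finset.mem_powersetCard]

open Finset in
theorem card_independentSets_mul_le {α : Type*} [Fintype α] {R : α → α → Prop}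
    (hrefl : ∀ x, R x x) (hsymm : ∀ x y, R x y → R y x) {d : ℕ}
    (hd : ∀ x, Set.ncard {y | R x y} ≤ d) (m : ℕ) :
    #(independentSets R m) * (Fintype.card α - m * d) ≤
      #(independentSets R (m + 1)) * (m + 1) := by
  classical
  refine card_mul_le_card_mul (fun s t => s ⊆ t) (fun s hs => ?_) (fun t ht => ?_)
  · obtain ⟨hcard, hpair⟩ := mem_independentSets.1 hs
    let free : Finset α := univ \ s.biUnion fun x => {y | R x y}
    have hfree : ∀ y ∈ free, ∀ x ∈ s, ¬ R x y := by
      intro y hy x hx hxy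
      simp only [free, mem_sdiff, mem_univ, true_and, mem_biUnion, mem_filter, not_exists,
        not_and] at hy
      exact hy x hx hxy
    have hnot : ∀ y ∈ free, y ∉ s := fun y hy hys => hfree y hy y hys (hrefl y)
    have hle : Fintype.card α - m * d ≤ #free := by
      have h1 : #(s.biUnion fun x => ({y | R x y} : Finset α)) ≤ #s * d := by
        refine card_biUnion_le_card_mul _ _ _ fun x _ => ?_
        have := hd x
        rwa [Set.ncard_eq_toFinset_card', Set.toFinset_ofPred] at this
      rw [hcard] at h1
      have h2 := le_card_sdiff (s.biUnion fun x => ({y | R x y} : Finset α)) (univ : Finset α)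
      rw [card_univ] at h2
      exact (Nat.sub_le_sub_left h1 _).trans h2
    refine hle.trans (card_le_card_of_injOn (fun y => insert y s) (fun y hy => ?_) ?_)
    · have hy' : y ∈ free := hy
      simp only [coe_bipartiteAbove, Set.mem_ofPred_eq]
      refine ⟨mem_independentSets.2 ⟨by rw [card_insert_of_notMem (hnot y hy'), hcard], ?_⟩,
        subset_insert _ _⟩
      rw [coe_insert]
      refine hpair.insert fun x hx _ => ⟨fun h => hfree y hy' x hx (hsymm _ _ h),
        hfree y hy' x hx⟩
    · intro y hy z hz hyz
      have : y ∈ insert z s := by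
        have h : insert y s = insert z s := hyz
        rw [← h]; exact mem_insert_self _ _
      exact (mem_insert.1 this).resolve_right (hnot y hy)
  · obtain ⟨hcard, -⟩ := mem_independentSets.1 ht
    have hsub : (independentSets R m).bipartiteBelow (fun s t => s ⊆ t) t ⊆ powersetCard m t := by
      intro s hs
      rw [mem_bipartiteBelow, mem_independentSets] at hs
      exact mem_powersetCard.2 ⟨hs.2, hs.1.1⟩
    refine (card_le_card hsub).trans ?_
    rw [card_powersetCard, hcard, Nat.choose_succ_self_right]

theorem prod_le_factorial_mul_card_independentSets {α : Type*} [Fintype α] {R : α → α → Prop}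
    (hrefl : ∀ x, R x x) (hsymm : ∀ x y, R x y → R y x) {d : ℕ}
    (hd : ∀ x, Set.ncard {y | R x y} ≤ d) (m : ℕ) :
    ∏ j ∈ Finset.range m, (Fintype.card α - j * d) ≤
      m.factorial * (independentSets R m).card := by
  induction m with
  | zero =>
    have : (∅ : Finset α) ∈ independentSets R 0 := by simp [mem_independentSets]
    simpa using Finset.card_pos.2 ⟨_, this⟩
  | succ m ih =>
    rw [Finset.prod_range_succ, Nat.factorial_succ]
    calc _ ≤ (m.factorial * (independentSets R m).card) * (Fintype.card α - m * d) :=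
          Nat.mul_le_mul_right _ ih
      _ = m.factorial * ((independentSets R m).card * (Fintype.card α - m * d)) := by ring
      _ ≤ m.factorial * ((independentSets R (m + 1)).card * (m + 1)) :=
          Nat.mul_le_mul_left _ (card_independentSets_mul_le hrefl hsymm hd m)
      _ = _ := by ring

theorem hammingNorm_sum_of_pairwise {ι κ β : Type*} [Fintype κ] [AddCommMonoid β] [DecidableEq β]
    (f : ι → κ → β) (s : Finset ι) {c : ℕ} (hc : ∀ j ∈ s, hammingNorm (f j) = c)
    (hs : (s : Set ι).Pairwise fun x y => ¬ ∃ l, f x l ≠ 0 ∧ f y l ≠ 0) :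
    hammingNorm (∑ j ∈ s, f j) = s.card * c := by
  classical
  have hsupp : (Finset.univ.filter fun l => (∑ j ∈ s, f j) l ≠ 0) =
      s.biUnion fun j => Finset.univ.filter fun l => f j l ≠ 0 := by
    ext l
    simp only [Finset.mem_filter, Finset.mem_univ, true_and, Finset.mem_biUnion, Finset.sum_apply]
    refine ⟨Finset.exists_ne_zero_of_sum_ne_zero, ?_⟩
    rintro ⟨j, hj, hjl⟩
    rwa [Finset.sum_eq_single_of_mem j hj]
    intro j' hj' hne
    by_contra h
    exact hs hj' hj hne ⟨l, h, hjl⟩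
  unfold hammingNorm
  rw [hsupp, Finset.card_biUnion]
  · exact Finset.sum_const_nat hc
  intro x hx y hy hxy
  refine Finset.disjoint_left.2 fun l hl hl' => hs hx hy hxy ⟨l, ?_, ?_⟩
  · simpa using hl
  · simpa using hl'

/-- Subset sums of a linearly independent family determine the subset. -/
theorem LinearIndependent.sum_finset_injective {ι K V : Type*} [Fintype ι] [Ring K] [Nontrivial K]
    [AddCommGroup V] [Module K V] {v : ι → V} (hv : LinearIndependent K v) :
    Function.Injective fun s : Finset ι => ∑ j ∈ s, v j := by
  classical
  intro s t hst
  have key : ∀ u : Finset ι, ∑ j ∈ u, v j = ∑ j, (if j ∈ u then (1 : K) else 0) • v j := by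
    intro u
    simp only [ite_smul, one_smul, zero_smul, Finset.sum_ite_mem, Finset.univ_inter]
  have h : ∑ j, (if j ∈ s then (1 : K) else 0) • v j =
      ∑ j, (if j ∈ t then (1 : K) else 0) • v j := by
    rw [← key, ← key]; exact hst
  ext j
  have := (Fintype.linearIndependent_iffₛ.1 hv) _ _ h j
  by_cases hs : j ∈ s <;> by_cases ht : j ∈ t <;> simp [hs, ht] at this ⊢

/-- The rows of `H` are the consecutive shifts of the vector `a`. -/
def IsShiftMatrix {r k : ℕ} (a : Fin (r + 1) → ZMod 2)
    (H : Matrix (Fin (k - r)) (Fin k) (ZMod 2)) : Prop :=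
  ∀ (j : Fin (k - r)) (i : Fin k),
    H j i =
      if h : (j : ℕ) ≤ (i : ℕ) ∧ (i : ℕ) ≤ (j : ℕ) + r
      then a ⟨(i : ℕ) - (j : ℕ), by omega⟩ else 0

namespace IsShiftMatrix

variable {r k : ℕ} {a : Fin (r + 1) → ZMod 2} {H : Matrix (Fin (k - r)) (Fin k) (ZMod 2)}

theorem apply (hH : IsShiftMatrix a H) (j : Fin (k - r)) (i : Fin k) :
    H j i =
      if h : (j : ℕ) ≤ (i : ℕ) ∧ (i : ℕ) ≤ (j : ℕ) + r
      then a ⟨(i : ℕ) - (j : ℕ), by omega⟩ else 0 :=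
  hH j i

theorem hammingNorm_row (hH : IsShiftMatrix a H) (j : Fin (k - r)) :
    hammingNorm (H j) = (Finset.univ.filter fun i : Fin (r + 1) => a i ≠ 0).card := by
  symm
  refine Finset.card_bij (fun p _ => ⟨j + p, by omega⟩) ?_ ?_ ?_
  · intro p hp
    have hp' : a p ≠ 0 := by simpa using hp
    have : (j : ℕ) + p ≤ j + r := by omega
    simpa [hH.apply, this] using hp'
  · intro p _ q _ h
    simpa [Fin.ext_iff] using h
  · intro l hl
    have hl' : H j l ≠ 0 := by simpa using hl
    rw [hH.apply] at hl'
    split_ifs at hl' with h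
    · exact ⟨_, by simpa using hl', Fin.ext (by simp; omega)⟩
    · exact absurd rfl hl'

theorem card_column_le (hH : IsShiftMatrix a H) (l : Fin k) :
    (Finset.univ.filter fun j => H j l ≠ 0).card ≤
      (Finset.univ.filter fun i : Fin (r + 1) => a i ≠ 0).card := by
  have hmem : ∀ j, H j l ≠ 0 → ∃ h : (j : ℕ) ≤ l ∧ (l : ℕ) ≤ j + r,
      a ⟨(l : ℕ) - j, by omega⟩ ≠ 0 := by
    intro j hj
    rw [hH.apply] at hj
    split_ifs at hj with h
    · exact ⟨h, hj⟩
    · exact absurd rfl hj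
  refine Finset.card_le_card_of_injOn (fun j => Fin.ofNat (r + 1) ((l : ℕ) - j)) ?_ ?_
  · intro j hj
    obtain ⟨h, ha⟩ := hmem j (by simpa using hj)
    have : Fin.ofNat (r + 1) ((l : ℕ) - j) = ⟨(l : ℕ) - j, by omega⟩ :=
      Fin.ext (Nat.mod_eq_of_lt (by omega))
    simp only [Finset.coe_filter, Finset.mem_univ, true_and, Set.mem_ofPred_eq]
    rwa [this]
  · intro j hj j' hj' heq
    obtain ⟨h, -⟩ := hmem j (by simpa using hj)
    obtain ⟨h', -⟩ := hmem j' (by simpa using hj')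
    have hval : ((l : ℕ) - j) % (r + 1) = ((l : ℕ) - j') % (r + 1) := congrArg Fin.val heq
    rw [Nat.mod_eq_of_lt (by omega), Nat.mod_eq_of_lt (by omega)] at hval
    exact Fin.ext (by omega)

theorem ncard_conflicts_le (hH : IsShiftMatrix a H) (j : Fin (k - r)) :
    Set.ncard {j' | ∃ l, H j l ≠ 0 ∧ H j' l ≠ 0} ≤
      (Finset.univ.filter fun i : Fin (r + 1) => a i ≠ 0).card ^ 2 := by
  have heq : {j' | ∃ l, H j l ≠ 0 ∧ H j' l ≠ 0} =
      (((Finset.univ.filter fun l => H j l ≠ 0).biUnion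
        fun l => Finset.univ.filter fun j' => H j' l ≠ 0 : Finset (Fin (k - r))) :
          Set (Fin (k - r))) := by
    ext j'; simp
  rw [heq, Set.ncard_coe_finset, sq]
  refine (Finset.card_biUnion_le_card_mul _ _ _ fun l _ => hH.card_column_le l).trans ?_
  exact Nat.mul_le_mul_right _ (hH.hammingNorm_row j).le

theorem linearIndependent_rows (hH : IsShiftMatrix a H) (ha0 : a 0 = 1) :
    LinearIndependent (ZMod 2) fun j => H j := by
  let M : Matrix (Fin (k - r)) (Fin (k - r)) (ZMod 2) :=
    H.submatrix id (Fin.castLE (Nat.sub_le k r))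
  have hdet : M.det = 1 := by
    rw [Matrix.det_of_isUpperTriangular]
    · refine Finset.prod_eq_one fun j _ => ?_
      simpa [M, hH.apply] using ha0
    · intro j l hlj
      have hlt : (l : ℕ) < j := hlj
      simp only [M, Matrix.submatrix_apply, id, hH.apply, Fin.val_castLE]
      exact dif_neg (by omega)
  have hM : LinearIndependent (ZMod 2) M.row :=
    Matrix.linearIndependent_rows_iff_isUnit.2
      ((Matrix.isUnit_iff_isUnit_det M).2 (by simp [hdet]))
  exact LinearIndependent.of_comp
    (LinearMap.funLeft (ZMod 2) (ZMod 2) (Fin.castLE (Nat.sub_le k r))) hM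

end IsShiftMatrix

theorem stmt7 (r k : ℕ) (hr : 1 ≤ r) (hk : r < k)
    (a : Fin (r + 1) → ZMod 2) (ha0 : a 0 = 1) (har : a (Fin.last r) = 1)
    (c : ℕ) (hc : c = (Finset.univ.filter fun i : Fin (r + 1) => a i ≠ 0).card)
    (H : Matrix (Fin (k - r)) (Fin k) (ZMod 2))
    (hH : ∀ (j : Fin (k - r)) (i : Fin k),
      H j i =
        if h : (j : ℕ) ≤ (i : ℕ) ∧ (i : ℕ) ≤ (j : ℕ) + r
        then a ⟨(i : ℕ) - (j : ℕ), by omega⟩ else 0)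
    (i : ℕ) (hi : 1 ≤ i) (hic : i * c ^ 2 ≤ k - r) :
    ∏ j ∈ Finset.range i, (k - r - j * c ^ 2) ≤
      Nat.factorial i *
        Set.ncard {v : Fin k → ZMod 2 |
          v ∈ Submodule.span (ZMod 2) (Set.range fun j : Fin (k - r) => H j) ∧
          hammingNorm v = i * c} := by
  have hS : IsShiftMatrix a H := hH
  let R : Fin (k - r) → Fin (k - r) → Prop := fun x y => ∃ l, H x l ≠ 0 ∧ H y l ≠ 0
  have hrefl : ∀ x, R x x := by
    intro x
    have : H x ⟨x, by omega⟩ ≠ 0 := by simp [hH, ha0]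
    exact ⟨_, this, this⟩
  have hsymm : ∀ x y, R x y → R y x := fun x y ⟨l, hx, hy⟩ => ⟨l, hy, hx⟩
  have hd : ∀ x, Set.ncard {y | R x y} ≤ c ^ 2 := fun x => hc ▸ hS.ncard_conflicts_le x
  have hprod := prod_le_factorial_mul_card_independentSets hrefl hsymm hd i
  rw [Fintype.card_fin] at hprod
  refine hprod.trans (Nat.mul_le_mul_left _ ?_)
  rw [← Set.ncard_coe_finset]
  refine Set.ncard_le_ncard_of_injOn (fun s => ∑ j ∈ s, H j) (fun s hs => ?_)
    (hS.linearIndependent_rows ha0).sum_finset_injective.injOn (Set.toFinite _)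
  obtain ⟨hcard, hpair⟩ := mem_independentSets.1 hs
  refine ⟨Submodule.sum_mem _ fun j _ => Submodule.subset_span ⟨j, rfl⟩, ?_⟩
  rw [← hcard]
  exact hammingNorm_sum_of_pairwise H s
    (fun j _ => (hS.hammingNorm_row j).trans hc.symm) hpair
end

section
/- Let 𝒳 and 𝒴 be finite nonempty sets, let W(y|x) be a discrete memoryless channel (W(·|x) is a probability mass function on 𝒴 for every x ∈ 𝒳), and let p be a probability mass function on 𝒳. Define I(p,W) = Σ_{x∈𝒳, y∈𝒴} p(x)·W(y|x)·log₂( W(y|x) / (Σ_{x'∈𝒳} p(x')·W(y|x')) ), where terms with p(x)·W(y|x) = 0 contribute 0. Then for every real R with 0 < R < I(p,W) and every ε > 0, there exists an integer K such that for every k ≥ K there exist an integer n ≥ 2^{Rk}, a sequence x ∈ 𝒳^n, and a detector g : 𝒴^k → {1,…,n} whose average probability of error satisfies (1/n)·Σ_{m=1}^{n} Σ_{y^k ∈ 𝒴^k : g(y^k) ≠ m} ∏_{i=0}^{k−1} W(y_{1+i} | x_{m+i}) ≤ ε, where the indices of x are taken cyclically modulo n. -/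
/-- Averaging over an i.i.d. sequence is unchanged when one coordinate is resampled. -/
lemma sum_prod_mul_eq_sum_resample {ι X : Type*} [Fintype ι] [DecidableEq ι] [Fintype X]
    (p : X → ℝ) (hp1 : ∑ v, p v = 1) (c : ι) (G : (ι → X) → ℝ) :
    ∑ x : ι → X, (∏ j, p (x j)) * G x =
      ∑ x : ι → X, (∏ j, p (x j)) * ∑ v, p v * G (Function.update x c v) := by
  have key : ∀ (x : ι → X) (v : X),
      (∏ j, p (Function.update x c v j)) * p (x c) = (∏ j, p (x j)) * p v := by
    intro x v
    rw [← Finset.mul_prod_erase Finset.univ _ (Finset.mem_univ c),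
      ← Finset.mul_prod_erase Finset.univ (fun j => p (x j)) (Finset.mem_univ c)]
    have : ∏ j ∈ Finset.univ.erase c, p (Function.update x c v j) =
        ∏ j ∈ Finset.univ.erase c, p (x j) :=
      Finset.prod_congr rfl fun j hj => by
        rw [Function.update_of_ne (Finset.ne_of_mem_erase hj)]
    rw [this, Function.update_self]
    ring
  have hinv : Function.Involutive
      (fun z : (ι → X) × X => (Function.update z.1 c z.2, z.1 c)) := by
    rintro ⟨x, v⟩
    simp
  calc ∑ x : ι → X, (∏ j, p (x j)) * G x
      = ∑ z : (ι → X) × X, (∏ j, p (z.1 j)) * p z.2 * G z.1 := by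
        rw [Fintype.sum_prod_type]
        refine Finset.sum_congr rfl fun x _ => ?_
        simp only
        rw [← Finset.sum_mul, ← Finset.mul_sum, hp1, mul_one]
    _ = ∑ z : (ι → X) × X, (∏ j, p (z.1 j)) * p z.2 * G (Function.update z.1 c z.2) := by
        rw [← Equiv.sum_comp hinv.toPerm]
        refine Finset.sum_congr rfl fun z _ => ?_
        simp only [Function.Involutive.coe_toPerm]
        rw [key]
    _ = _ := by
        rw [Fintype.sum_prod_type]
        refine Finset.sum_congr rfl fun x _ => ?_
        rw [Finset.mul_sum]
        exact Finset.sum_congr rfl fun v _ => by ring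

/-- If the `i`-th factor is the first one to involve the coordinate `b i`, and averaging it over
that coordinate alone gives at most `C`, then the product of `k` factors averages to at most
`C ^ k`. -/
lemma sum_prod_mul_prod_le_pow {ι X : Type*} [Fintype ι] [DecidableEq ι] [Fintype X]
    (p : X → ℝ) (hp0 : ∀ v, 0 ≤ p v) (hp1 : ∑ v, p v = 1) (C : ℝ) (hC : 0 ≤ C)
    (b : ℕ → ι) (h : ℕ → (ι → X) → ℝ) (hh : ∀ i x, 0 ≤ h i x) (k : ℕ)
    (hind : ∀ i < k, ∀ j < i, ∀ x v, h j (Function.update x (b i) v) = h j x)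
    (hle : ∀ i < k, ∀ x, ∑ v, p v * h i (Function.update x (b i) v) ≤ C) :
    ∑ x : ι → X, (∏ j, p (x j)) * ∏ i ∈ Finset.range k, h i x ≤ C ^ k := by
  induction k with
  | zero =>
    have : ∑ x : ι → X, ∏ j, p (x j) = 1 := by
      rw [← Fintype.prod_sum]
      simp [hp1]
    simp [this]
  | succ k ih =>
    have ih' := ih (fun i hi => hind i (by omega)) (fun i hi => hle i (by omega))
    rw [sum_prod_mul_eq_sum_resample p hp1 (b k)]
    calc _ ≤ ∑ x : ι → X, ((∏ j, p (x j)) * ∏ i ∈ Finset.range k, h i x) * C := by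
          refine Finset.sum_le_sum fun x _ => ?_
          rw [mul_assoc]
          refine mul_le_mul_of_nonneg_left ?_ (Finset.prod_nonneg fun j _ => hp0 _)
          calc _ = (∏ i ∈ Finset.range k, h i x) *
                ∑ v, p v * h k (Function.update x (b k) v) := by
                rw [Finset.mul_sum]
                refine Finset.sum_congr rfl fun v _ => ?_
                rw [Finset.prod_range_succ, Finset.prod_congr rfl fun i hi =>
                  hind k (by omega) i (Finset.mem_range.1 hi) x v]
                ring
            _ ≤ _ := mul_le_mul_of_nonneg_left (hle k (by omega) x)
                (Finset.prod_nonneg fun i _ => hh i x)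
      _ ≤ C ^ (k + 1) := by
          rw [← Finset.sum_mul, pow_succ]
          exact mul_le_mul_of_nonneg_right ih' hC

/-- Exponential tilting: a finitely supported random variable whose logarithm has positive mean
has some negative moment below one. -/
lemma exists_sum_mul_rpow_neg_lt_one {Z : Type*} [Fintype Z] (w a : Z → ℝ)
    (hw1 : ∑ z, w z = 1) (ha : ∀ z, w z ≠ 0 → 0 < a z)
    (hpos : 0 < ∑ z, w z * Real.log (a z)) :
    ∃ s : ℝ, 0 < s ∧ ∑ z, w z * a z ^ (-s) < 1 := by
  have hd : HasDerivAt (fun s : ℝ => ∑ z, w z * a z ^ (-s))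
      (∑ z, -(w z * Real.log (a z))) 0 := by
    refine HasDerivAt.fun_sum fun z _ => ?_
    by_cases hz : w z = 0
    · simpa [hz] using hasDerivAt_const (0 : ℝ) (0 : ℝ)
    · have h1 := ((hasDerivAt_neg (0 : ℝ)).const_rpow (ha z hz)).const_mul (w z)
      refine h1.congr_deriv ?_
      simp
  have ht := hd.tendsto_slope_zero_right
  have hneg : ∑ z, -(w z * Real.log (a z)) < 0 := by
    rw [Finset.sum_neg_distrib]
    linarith
  obtain ⟨s, hs, hs0⟩ := ((ht.eventually (gt_mem_nhds hneg)).and self_mem_nhdsWithin).exists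
  refine ⟨s, hs0, ?_⟩
  have hs0' : (0 : ℝ) < s := hs0
  simp only [zero_add, neg_zero, Real.rpow_zero, mul_one, hw1, smul_eq_mul] at hs
  have := (pos_iff_neg_of_mul_neg hs).1 (inv_pos.2 hs0')
  linarith

/-- The average of a product of pair functions along two trajectories of a sequence indexed
cyclically, when each coordinate visited by the second trajectory is new. -/
lemma sum_prod_mul_prod_pair_le_pow {X : Type*} [Fintype X] {n : ℕ} [NeZero n]
    (p : X → ℝ) (hp0 : ∀ v, 0 ≤ p v) (hp1 : ∑ v, p v = 1) (C : ℝ) (hC : 0 ≤ C)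
    (ψ : X → X → ℝ) (hψ0 : ∀ u v, 0 ≤ ψ u v) (hψ : ∀ u, ∑ v, p v * ψ u v ≤ C)
    (c : ZMod n) (k : ℕ) (α β : ℕ → ℕ) (hα : ∀ i < k, α i < n) (hβ : ∀ i < k, β i < n)
    (hαβ : ∀ i < k, ∀ j ≤ i, α j ≠ β i) (hββ : ∀ i < k, ∀ j < i, β j ≠ β i) :
    ∑ x : ZMod n → X, (∏ j, p (x j)) *
      ∏ i ∈ Finset.range k, ψ (x (c + (α i : ZMod n))) (x (c + (β i : ZMod n))) ≤ C ^ k := by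
  have cast_ne : ∀ a b : ℕ, a < n → b < n → a ≠ b → c + (a : ZMod n) ≠ c + (b : ZMod n) := by
    intro a b ha hb hab h
    apply hab
    have := (ZMod.natCast_eq_natCast_iff' a b n).1 (add_left_cancel h)
    rwa [Nat.mod_eq_of_lt ha, Nat.mod_eq_of_lt hb] at this
  refine sum_prod_mul_prod_le_pow p hp0 hp1 C hC (fun i => c + (β i : ZMod n))
    (fun i x => ψ (x (c + (α i : ZMod n))) (x (c + (β i : ZMod n))))
    (fun i x => hψ0 _ _) k ?_ ?_
  · intro i hi j hj x v
    rw [Function.update_of_ne (cast_ne _ _ (hα j (by omega)) (hβ i hi) (hαβ i hi j hj.le)),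
      Function.update_of_ne (cast_ne _ _ (hβ j (by omega)) (hβ i hi) (hββ i hi j hj))]
  · intro i hi x
    simp only [Function.update_self]
    simp only [Function.update_of_ne (cast_ne _ _ (hα i hi) (hβ i hi) (hαβ i hi i le_rfl))]
    exact hψ _

lemma sum_prod_mul_prod_win_le_pow {X : Type*} [Fintype X] {n : ℕ} [NeZero n]
    (p : X → ℝ) (hp0 : ∀ v, 0 ≤ p v) (hp1 : ∑ v, p v = 1) (C : ℝ) (hC : 0 ≤ C)
    (φ : X → ℝ) (hφ0 : ∀ v, 0 ≤ φ v) (hφ : ∑ v, p v * φ v ≤ C) (k : ℕ) (hk : k < n)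
    (m : ZMod n) :
    ∑ x : ZMod n → X, (∏ j, p (x j)) * ∏ i, φ (win k x m i) ≤ C ^ k := by
  have := sum_prod_mul_prod_pair_le_pow p hp0 hp1 C hC (fun _ v => φ v) (fun _ v => hφ0 v)
    (fun _ => hφ) m k (fun _ => k) (fun i => i) (fun _ _ => hk) (fun _ _ => by omega)
    (fun _ _ _ _ => by omega) (fun _ _ _ _ => by omega)
  simpa only [Finset.prod_range, win] using this

/-- Two distinct windows, overlapping or not, contribute as if they were independent. -/
lemma sum_prod_mul_prod_win_win_le_pow {X : Type*} [Fintype X] {n : ℕ} [NeZero n]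
    (p : X → ℝ) (hp0 : ∀ v, 0 ≤ p v) (hp1 : ∑ v, p v = 1) (C : ℝ) (hC : 0 ≤ C)
    (ψ : X → X → ℝ) (hψ0 : ∀ u v, 0 ≤ ψ u v) (hψ : ∀ u, ∑ v, p v * ψ u v ≤ C)
    (k : ℕ) (hk : 2 * k < n) (m m' : ZMod n) (hm : m' ≠ m) :
    ∑ x : ZMod n → X, (∏ j, p (x j)) * ∏ i, ψ (win k x m i) (win k x m' i) ≤ C ^ k := by
  obtain ⟨d, hd, hdn, hmd⟩ : ∃ d : ℕ, 0 < d ∧ d < n ∧ m' = m + (d : ZMod n) := by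
    refine ⟨(m' - m).val, ?_, ZMod.val_lt _, by simp⟩
    rw [Nat.pos_iff_ne_zero, Ne, ZMod.val_eq_zero, sub_eq_zero]
    exact hm
  rcases le_or_gt (d + k) n with hdk | hdk
  · have := sum_prod_mul_prod_pair_le_pow p hp0 hp1 C hC ψ hψ0 hψ m k
      (fun i => i) (fun i => d + i) (fun _ _ => by omega) (fun _ _ => by omega)
      (fun _ _ _ _ => by omega) (fun _ _ _ _ => by omega)
    simpa only [Finset.prod_range, win, hmd, Nat.cast_add, add_assoc] using this
  · have hmd' : m = m' + ((n - d : ℕ) : ZMod n) := by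
      rw [hmd, add_assoc, ← Nat.cast_add, Nat.add_sub_cancel' hdn.le]
      simp
    have := sum_prod_mul_prod_pair_le_pow p hp0 hp1 C hC ψ hψ0 hψ m' k
      (fun i => (n - d) + (k - 1 - i)) (fun i => k - 1 - i) (fun _ _ => by omega)
      (fun _ _ => by omega) (fun _ _ _ _ => by omega) (fun _ _ _ _ => by omega)
    refine le_trans (le_of_eq (Finset.sum_congr rfl fun x _ => ?_)) this
    rw [Finset.prod_range_reflect (fun i =>
      ψ (x (m' + ((n - d + i : ℕ) : ZMod n))) (x (m' + (i : ZMod n)))) k, Finset.prod_range]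
    simp only [win, hmd', Nat.cast_add, add_assoc]

/-- Threshold decoding: the detector announces a phase whose window has likelihood ratio at least
one with the observation; the error is bounded by a Chernoff term and Markov terms. -/
lemma exists_detector_error_le {X Y : Type*} [Fintype Y] {n : ℕ} [NeZero n]
    (W a : X → Y → ℝ) (hW0 : ∀ x y, 0 ≤ W x y) (ha0 : ∀ x y, 0 ≤ a x y)
    (s : ℝ) (hs : 0 < s) (k : ℕ) (x : ZMod n → X)
    (hx : ∀ j y, W (x j) y ≠ 0 → 0 < a (x j) y) :
    ∃ g : (Fin k → Y) → ZMod n, ∀ m,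
      ∑ y ∈ Finset.univ.filter (fun y : Fin k → Y => g y ≠ m),
          ∏ i : Fin k, W (win k x m i) (y i) ≤
        (∏ i, ∑ y, W (win k x m i) y * a (win k x m i) y ^ (-s)) +
        ∑ m' ∈ Finset.univ.erase m,
          ∏ i, ∑ y, W (win k x m i) y * a (win k x m' i) y := by
  classical
  let A : (Fin k → Y) → ZMod n → Prop := fun y m => 1 ≤ ∏ i, a (win k x m i) (y i)
  refine ⟨fun y => if h : ∃ m, A y m then h.choose else 0, fun m => ?_⟩
  simp only [Fintype.prod_sum]
  rw [Finset.sum_comm, ← Finset.sum_add_distrib]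
  have h1 : ∀ y : Fin k → Y, 0 ≤ ∏ i, W (win k x m i) (y i) * a (win k x m i) (y i) ^ (-s) :=
    fun y => Finset.prod_nonneg fun i _ => mul_nonneg (hW0 _ _) (Real.rpow_nonneg (ha0 _ _) _)
  have h2 : ∀ (y : Fin k → Y) (m' : ZMod n),
      0 ≤ ∏ i, W (win k x m i) (y i) * a (win k x m' i) (y i) :=
    fun y m' => Finset.prod_nonneg fun i _ => mul_nonneg (hW0 _ _) (ha0 _ _)
  have hW : ∀ y : Fin k → Y, 0 ≤ ∏ i, W (win k x m i) (y i) :=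
    fun y => Finset.prod_nonneg fun i _ => hW0 _ _
  refine le_trans (Finset.sum_le_sum fun y hy => ?_)
    (Finset.sum_le_sum_of_subset_of_nonneg (Finset.filter_subset _ _) fun y _ _ =>
      add_nonneg (h1 y) (Finset.sum_nonneg fun m' _ => h2 y m'))
  have hgy := (Finset.mem_filter.1 hy).2
  by_cases hA : A y m
  · have hex : ∃ m, A y m := ⟨m, hA⟩
    rw [dif_pos hex] at hgy
    have hc : 1 ≤ ∏ i, a (win k x hex.choose i) (y i) := hex.choose_spec
    refine le_trans ?_ (le_add_of_nonneg_left (h1 y))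
    refine le_trans ?_ (Finset.single_le_sum (fun m' _ => h2 y m')
      (Finset.mem_erase.2 ⟨hgy, Finset.mem_univ _⟩))
    rw [Finset.prod_mul_distrib]
    exact le_mul_of_one_le_right (hW y) hc
  · refine le_trans ?_ (le_add_of_nonneg_right (Finset.sum_nonneg fun m' _ => h2 y m'))
    by_cases h0 : ∏ i, W (win k x m i) (y i) = 0
    · rw [h0]
      exact h1 y
    · have hpos : 0 < ∏ i, a (win k x m i) (y i) :=
        Finset.prod_pos fun i hi => hx _ _ (Finset.prod_ne_zero_iff.1 h0 i hi)
      rw [Finset.prod_mul_distrib, Real.finsetProd_rpow _ _ fun i _ => ha0 _ _]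
      exact le_mul_of_one_le_right (hW y)
        (Real.one_le_rpow_of_pos_of_le_one_of_nonpos hpos (not_le.1 hA).le (by linarith))

/-- A quantity whose weighted average is at most `B` is at most `B` at a point of nonzero
weight. -/
lemma exists_le_of_weighted_sum_le {Z : Type*} [Fintype Z] (P F : Z → ℝ) (B : ℝ)
    (hP0 : ∀ z, 0 ≤ P z) (hP1 : ∑ z, P z = 1) (h : ∑ z, P z * F z ≤ B) :
    ∃ z, P z ≠ 0 ∧ F z ≤ B := by
  by_contra! hcon
  obtain ⟨z, -, hz⟩ : ∃ z ∈ Finset.univ, P z ≠ 0 :=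
    Finset.exists_ne_zero_of_sum_ne_zero (by rw [hP1]; exact one_ne_zero)
  have : ∑ z, P z * B < ∑ z, P z * F z := by
    refine Finset.sum_lt_sum (fun z _ => ?_) ⟨z, Finset.mem_univ _, ?_⟩
    · by_cases h0 : P z = 0
      · simp [h0]
      · exact mul_le_mul_of_nonneg_left (hcon z h0).le (hP0 z)
    · exact mul_lt_mul_of_pos_left (hcon z hz) (lt_of_le_of_ne (hP0 z) hz.symm)
  rw [← Finset.sum_mul, hP1, one_mul] at this
  linarith

/-- The random coding bound for phase detection. -/
lemma exists_sequence_error_le {X Y : Type*} [Fintype X] [Fintype Y] {n : ℕ} [NeZero n]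
    (W a : X → Y → ℝ) (hW0 : ∀ x y, 0 ≤ W x y) (ha0 : ∀ x y, 0 ≤ a x y)
    (p : X → ℝ) (hp0 : ∀ v, 0 ≤ p v) (hp1 : ∑ v, p v = 1)
    (hsupp : ∀ v y, p v * W v y ≠ 0 → 0 < a v y)
    (s c t : ℝ) (hs : 0 < s) (hc0 : 0 ≤ c) (ht0 : 0 ≤ t)
    (hc : ∑ v, p v * ∑ y, W v y * a v y ^ (-s) ≤ c)
    (ht : ∀ u, ∑ v, p v * ∑ y, W u y * a v y ≤ t)
    (k : ℕ) (hk : 2 * k < n) :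
    ∃ (x : ZMod n → X) (g : (Fin k → Y) → ZMod n),
      (1 / (n : ℝ)) * ∑ m : ZMod n,
        ∑ y ∈ Finset.univ.filter (fun y : Fin k → Y => g y ≠ m),
          ∏ i : Fin k, W (win k x m i) (y i) ≤ c ^ k + n * t ^ k := by
  have hn : (0 : ℝ) < n := by exact_mod_cast NeZero.pos n
  let F : (ZMod n → X) → ℝ := fun x => ∑ m : ZMod n,
    ((∏ i, ∑ y, W (win k x m i) y * a (win k x m i) y ^ (-s)) +
      ∑ m' ∈ Finset.univ.erase m, ∏ i, ∑ y, W (win k x m i) y * a (win k x m' i) y)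
  obtain ⟨x, hPx, hFx⟩ := exists_le_of_weighted_sum_le
    (fun x : ZMod n → X => ∏ j, p (x j)) F (n * (c ^ k + n * t ^ k))
    (fun x => Finset.prod_nonneg fun j _ => hp0 _)
    (by rw [← Fintype.prod_sum (fun (_ : ZMod n) v => p v)]; simp [hp1]) (by
      simp only [F, Finset.mul_sum _ _ (∏ j, p _)]
      rw [Finset.sum_comm]
      have hbound : ∀ m : ZMod n, ∑ x : ZMod n → X, (∏ j, p (x j)) *
          ((∏ i, ∑ y, W (win k x m i) y * a (win k x m i) y ^ (-s)) +
            ∑ m' ∈ Finset.univ.erase m, ∏ i, ∑ y, W (win k x m i) y * a (win k x m' i) y) ≤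
          c ^ k + n * t ^ k := by
        intro m
        simp only [mul_add, Finset.sum_add_distrib, Finset.mul_sum _ _ (∏ j, p _)]
        refine add_le_add ?_ ?_
        · exact sum_prod_mul_prod_win_le_pow p hp0 hp1 c hc0
            (fun v => ∑ y, W v y * a v y ^ (-s))
            (fun v => Finset.sum_nonneg fun y _ =>
              mul_nonneg (hW0 _ _) (Real.rpow_nonneg (ha0 _ _) _)) hc k (by omega) m
        · rw [Finset.sum_comm]
          refine le_trans (Finset.sum_le_card_nsmul _ _ (t ^ k) fun m' hm' =>
            sum_prod_mul_prod_win_win_le_pow p hp0 hp1 t ht0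
              (fun u v => ∑ y, W u y * a v y)
              (fun u v => Finset.sum_nonneg fun y _ => mul_nonneg (hW0 _ _) (ha0 _ _))
              ht k hk m m' (Finset.ne_of_mem_erase hm')) ?_
          rw [nsmul_eq_mul]
          refine mul_le_mul_of_nonneg_right ?_ (pow_nonneg ht0 k)
          have := Finset.card_le_univ (Finset.univ.erase m)
          rw [ZMod.card] at this
          exact_mod_cast this
      refine le_trans (Finset.sum_le_card_nsmul _ _ _ fun m _ => hbound m) ?_
      rw [nsmul_eq_mul, Finset.card_univ, ZMod.card])
  obtain ⟨g, hg⟩ := exists_detector_error_le W a hW0 ha0 s hs k x fun j y hjy =>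
    hsupp _ _ (mul_ne_zero (Finset.prod_ne_zero_iff.1 hPx j (Finset.mem_univ j)) hjy)
  refine ⟨x, g, ?_⟩
  rw [one_div, inv_mul_le_iff₀ hn]
  exact le_trans (Finset.sum_le_sum fun m _ => hg m) hFx

theorem stmt8 {X Y : Type*} [Fintype X] [Fintype Y] [Nonempty X] [Nonempty Y]
    [DecidableEq Y]
    (W : X → Y → ℝ) (hW0 : ∀ x y, 0 ≤ W x y) (hW1 : ∀ x, ∑ y : Y, W x y = 1)
    (p : X → ℝ) (hp0 : ∀ x, 0 ≤ p x) (hp1 : ∑ x : X, p x = 1)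
    (R : ℝ) (hR0 : 0 < R)
    (hRI : R < ∑ x : X, ∑ y : Y,
      p x * W x y * Real.logb 2 (W x y / ∑ x' : X, p x' * W x' y))
    (ε : ℝ) (hε : 0 < ε) :
    ∃ K : ℕ, ∀ k : ℕ, K ≤ k →
      ∃ (n : ℕ) (_ : NeZero n),
        (2 : ℝ) ^ (R * k) ≤ n ∧
        ∃ (x : ZMod n → X) (g : (Fin k → Y) → ZMod n),
          (1 / (n : ℝ)) * ∑ m : ZMod n,
            ∑ y ∈ Finset.univ.filter (fun y : Fin k → Y => g y ≠ m),
              ∏ i : Fin k, W (win k x m i) (y i) ≤ ε := by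
  set q : Y → ℝ := fun y => ∑ x', p x' * W x' y with hq
  set I : ℝ := ∑ x : X, ∑ y : Y, p x * W x y * Real.logb 2 (W x y / q y) with hI
  obtain ⟨T, hRT, hTI⟩ := exists_between hRI
  have hq0 : ∀ y, 0 ≤ q y := fun y => Finset.sum_nonneg fun v _ => mul_nonneg (hp0 v) (hW0 v y)
  have hr : ∀ v y, p v * W v y ≠ 0 → 0 < W v y / q y := by
    intro v y hvy
    have h1 : 0 < p v * W v y := lt_of_le_of_ne (mul_nonneg (hp0 v) (hW0 v y)) hvy.symm
    have h2 : p v * W v y ≤ q y :=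
      Finset.single_le_sum (f := fun v => p v * W v y)
        (fun v _ => mul_nonneg (hp0 v) (hW0 v y)) (Finset.mem_univ v)
    exact div_pos (lt_of_le_of_ne (hW0 v y) (right_ne_zero_of_mul hvy).symm) (h1.trans_le h2)
  set t : ℝ := 2 ^ (-T) with ht
  have ht0 : 0 < t := Real.rpow_pos_of_pos two_pos _
  let a : X → Y → ℝ := fun v y => t * (W v y / q y)
  have ha0 : ∀ v y, 0 ≤ a v y := fun v y =>
    mul_nonneg ht0.le (div_nonneg (hW0 v y) (hq0 y))
  have hsupp : ∀ v y, p v * W v y ≠ 0 → 0 < a v y := fun v y h => mul_pos ht0 (hr v y h)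
  have hpW : ∑ z : X × Y, p z.1 * W z.1 z.2 = 1 := by
    simp only [Fintype.sum_prod_type, ← Finset.mul_sum, hW1, mul_one, hp1]
  have hlog2 : 0 < Real.log 2 := Real.log_pos one_lt_two
  have hlog : ∑ z : X × Y, p z.1 * W z.1 z.2 * Real.log (a z.1 z.2) =
      Real.log 2 * (I - T) := by
    have hterm : ∀ z : X × Y, p z.1 * W z.1 z.2 * Real.log (a z.1 z.2) =
        Real.log 2 * (p z.1 * W z.1 z.2 * Real.logb 2 (W z.1 z.2 / q z.2)) -
          Real.log 2 * T * (p z.1 * W z.1 z.2) := by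
      intro z
      by_cases hz : p z.1 * W z.1 z.2 = 0
      · simp [hz]
      · rw [Real.log_mul ht0.ne' (hr _ _ hz).ne', ht, Real.log_rpow two_pos, Real.logb]
        field_simp
        ring
    rw [Finset.sum_congr rfl fun z _ => hterm z, Finset.sum_sub_distrib, ← Finset.mul_sum,
      ← Finset.mul_sum, hpW, Fintype.sum_prod_type, ← hI]
    ring
  obtain ⟨s, hs, hlt⟩ := exists_sum_mul_rpow_neg_lt_one
    (fun z : X × Y => p z.1 * W z.1 z.2) (fun z => a z.1 z.2) hpW
    (fun z hz => hsupp _ _ hz) (by rw [hlog]; exact mul_pos hlog2 (by linarith))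
  set c : ℝ := ∑ v, p v * ∑ y, W v y * a v y ^ (-s) with hc
  have hc0 : 0 ≤ c := Finset.sum_nonneg fun v _ => mul_nonneg (hp0 v) <|
    Finset.sum_nonneg fun y _ => mul_nonneg (hW0 _ _) (Real.rpow_nonneg (ha0 _ _) _)
  have hc1 : c < 1 := by
    refine lt_of_eq_of_lt ?_ hlt
    simp only [hc, Fintype.sum_prod_type, Finset.mul_sum, mul_assoc]
  have hta : ∀ u, ∑ v, p v * ∑ y, W u y * a v y ≤ t := by
    intro u
    calc ∑ v, p v * ∑ y, W u y * a v y = ∑ y, W u y * (t * (q y / q y)) := by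
          simp only [Finset.mul_sum]
          rw [Finset.sum_comm]
          refine Finset.sum_congr rfl fun y _ => ?_
          rw [hq, Finset.sum_div, Finset.mul_sum, Finset.mul_sum]
          exact Finset.sum_congr rfl fun v _ => by simp only [a, hq]; ring
      _ ≤ ∑ y, W u y * t := Finset.sum_le_sum fun y _ =>
          mul_le_mul_of_nonneg_left (mul_le_of_le_one_right ht0.le (div_self_le_one _)) (hW0 u y)
      _ = t := by rw [← Finset.sum_mul, hW1, one_mul]
  have ht1 : t < 1 := Real.rpow_lt_one_of_one_lt_of_neg one_lt_two (by linarith)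
  set ρ : ℝ := 2 ^ R with hρ
  have hρ0 : 0 < ρ := Real.rpow_pos_of_pos two_pos _
  have hρt : ρ * t < 1 := by
    rw [hρ, ht, ← Real.rpow_add two_pos]
    exact Real.rpow_lt_one_of_one_lt_of_neg one_lt_two (by linarith)
  have hlim : Filter.Tendsto
      (fun k : ℕ => c ^ k + ((ρ * t) ^ k + 2 * (k * t ^ k) + 2 * t ^ k))
      Filter.atTop (nhds (0 + (0 + 2 * 0 + 2 * 0))) :=
    (tendsto_pow_atTop_nhds_zero_of_lt_one hc0 hc1).add
      (((tendsto_pow_atTop_nhds_zero_of_lt_one (mul_pos hρ0 ht0).le hρt).add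
        ((tendsto_self_mul_const_pow_of_lt_one ht0.le ht1).const_mul 2)).add
        ((tendsto_pow_atTop_nhds_zero_of_lt_one ht0.le ht1).const_mul 2))
  obtain ⟨K, hK⟩ := Filter.eventually_atTop.1
    (hlim.eventually (ge_mem_nhds (by simpa using hε)))
  refine ⟨K, fun k hk => ?_⟩
  have hpow : (2 : ℝ) ^ (R * k) = ρ ^ k := by rw [hρ, Real.rpow_mul_natCast two_pos.le]
  refine ⟨⌈ρ ^ k⌉₊ + (2 * k + 1), ⟨by omega⟩, ?_, ?_⟩
  · rw [hpow]
    exact (Nat.le_ceil _).trans (by exact_mod_cast Nat.le_add_right _ _)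
  · have : NeZero (⌈ρ ^ k⌉₊ + (2 * k + 1)) := ⟨by omega⟩
    obtain ⟨x, g, hxg⟩ := exists_sequence_error_le (n := ⌈ρ ^ k⌉₊ + (2 * k + 1)) W a hW0 ha0 p
      hp0 hp1 hsupp s c t hs hc0 ht0.le le_rfl hta k (by omega)
    refine ⟨x, g, hxg.trans (le_trans ?_ (hK k hk))⟩
    have hceil : (⌈ρ ^ k⌉₊ : ℝ) ≤ ρ ^ k + 1 := (Nat.ceil_lt_add_one (pow_pos hρ0 k).le).le
    have hn : ((⌈ρ ^ k⌉₊ + (2 * k + 1) : ℕ) : ℝ) ≤ ρ ^ k + 2 * k + 2 := by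
      push_cast
      linarith
    have := mul_le_mul_of_nonneg_right hn (pow_pos ht0 k).le
    rw [mul_pow]
    linarith
end

section
/- Let G be a simple graph on a finite vertex set V. Call two tuples u, v ∈ V^ℓ distinguishable if there exists an index i with u_i ≠ v_i and (u_i, v_i) not adjacent in G. Suppose there exist an integer t ≥ 1 and a set S ⊆ V^t with |S| ≥ 2 such that every two distinct elements of S are distinguishable. Then for every real R with 0 < R < log₂|S| / t and every integer K, there exist an integer k ≥ K, an integer n ≥ 2^{Rk}, and a sequence x ∈ V^n such that for every pair of distinct phases m ≠ m' in {1,…,n}, the length-k cyclic windows φ(m) and φ(m') are distinguishable. -/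
/-- A maximal-length linear recurring sequence over `ZMod p`. -/
theorem exists_periodic_window_injective (p : ℕ) [Fact p.Prime] (r : ℕ) (hr : r ≠ 0) :
    ∃ s : ℕ → ZMod p, Function.Periodic s (p ^ r - 1) ∧
      ∀ i j, (∀ l < r, s (i + l) = s (j + l)) → i ≡ j [MOD p ^ r - 1] := by
  let E := GaloisField p r
  have : Fintype E := Fintype.ofFinite E
  obtain ⟨g, hg⟩ := IsCyclic.exists_generator (α := Eˣ)
  have hord : orderOf g = p ^ r - 1 := by
    rw [orderOf_eq_card_of_forall_mem_zpowers hg, Nat.card_units, GaloisField.card p r hr]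
  obtain ⟨f, e, hfe⟩ : ∃ f : Module.Dual (ZMod p) E, ∃ e, f e ≠ 0 := by
    by_contra! h
    exact one_ne_zero ((Module.forall_dual_apply_eq_zero_iff (ZMod p) (1 : E)).1 fun f => h f 1)
  refine ⟨fun i => f ((g : E) ^ i), fun i => ?_, fun i j hij => ?_⟩
  · have : (g : E) ^ (p ^ r - 1) = 1 := by
      rw [← hord, ← Units.val_pow_eq_pow_val, pow_orderOf_eq_one, Units.val_one]
    simp [pow_add, this]
  · have hspan : ∀ x y : E, (∀ l < r, f (x * (g : E) ^ l) = 0) → f (x * y) = 0 := by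
      intro x y hx
      rcases eq_or_ne y 0 with rfl | hy
      · simp
      obtain ⟨l, hl⟩ := (mem_powers_iff_mem_zpowers).2 (hg (Units.mk0 y hy))
      have hint : IsIntegral (ZMod p) (g : E) := Algebra.IsIntegral.isIntegral _
      have hmon := minpoly.monic hint
      have hdeg : (minpoly (ZMod p) (g : E)).natDegree ≤ r :=
        (minpoly.natDegree_le (g : E)).trans (GaloisField.finrank p hr).le
      have hyl : y = Polynomial.aeval (g : E)
          ((Polynomial.X ^ l : Polynomial (ZMod p)) %ₘ minpoly (ZMod p) (g : E)) := by
        rw [Polynomial.aeval_modByMonic_eq_self_of_root (minpoly.aeval _ _)]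
        simpa using (congrArg Units.val hl).symm
      have hlt : ((Polynomial.X ^ l : Polynomial (ZMod p)) %ₘ
          minpoly (ZMod p) (g : E)).natDegree < r :=
        (Polynomial.natDegree_modByMonic_lt _ hmon (minpoly.ne_one _ _)).trans_le hdeg
      rw [hyl, Polynomial.aeval_eq_sum_range' hlt, Finset.mul_sum, map_sum]
      refine Finset.sum_eq_zero fun l hl => ?_
      rw [mul_smul_comm, map_smul, hx l (Finset.mem_range.1 hl), smul_zero]
    have hzero : (g : E) ^ i - (g : E) ^ j = 0 := by
      by_contra hne
      apply hfe
      rw [← mul_inv_cancel_left₀ hne e]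
      refine hspan _ _ fun l hl => ?_
      rw [sub_mul, ← pow_add, ← pow_add, map_sub, sub_eq_zero]
      exact hij l hl
    rw [← hord, ← pow_eq_pow_iff_modEq]
    exact Units.ext (by simpa using sub_eq_zero.1 hzero)

/-- Every shift by `1 ≤ d ≤ w ^ 2 - w` maps one of the positions `0, …, w - 1` of a block of
length `w ^ 2` to one of the positions `w, 2 w, …, (w - 1) w`. -/
theorem exists_marker_offset_of_add_modEq {w m m' d : ℕ} (hd : d ≠ 0) (hle : d ≤ w ^ 2 - w)
    (hmod : m + d ≡ m' [MOD w ^ 2]) :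
    ∃ i < w ^ 2, (m + i) % w ^ 2 / w = 0 ∧
      (m' + i) % w ^ 2 / w ≠ 0 ∧ (m' + i) % w ^ 2 % w = 0 := by
  have hw : 0 < w := by
    rcases Nat.eq_zero_or_pos w with rfl | hw
    · simp at hle; omega
    · exact hw
  have hL : 0 < w ^ 2 := by positivity
  have hww : w ≤ w ^ 2 := Nat.le_self_pow (by norm_num) w
  obtain ⟨j, c, hc, hj⟩ : ∃ j c : ℕ, c < w ∧ j * w = c + d := by
    refine ⟨(d + w - 1) / w, (d + w - 1) / w * w - d, ?_, ?_⟩ <;>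
    · have h1 := Nat.div_add_mod (d + w - 1) w
      have h2 := Nat.mod_lt (d + w - 1) hw
      rw [mul_comm] at h1
      omega
  have hj0 : j ≠ 0 := by rintro rfl; omega
  have hjL : j * w < w ^ 2 := by omega
  have hi : m + (c + (w ^ 2 - m % w ^ 2)) ≡ c [MOD w ^ 2] := by
    have h1 := Nat.div_add_mod m (w ^ 2)
    have h2 := Nat.mod_lt m hL
    have h3 : m + (c + (w ^ 2 - m % w ^ 2)) = c + w ^ 2 * (m / w ^ 2 + 1) := by
      rw [mul_add]; omega
    rw [h3]
    exact Nat.add_mul_mod_self_left _ _ _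
  have hi' : m + (c + (w ^ 2 - m % w ^ 2)) % w ^ 2 ≡ c [MOD w ^ 2] :=
    (Nat.ModEq.add_left m (Nat.mod_modEq _ _)).trans hi
  have hi'' : m' + (c + (w ^ 2 - m % w ^ 2)) % w ^ 2 ≡ j * w [MOD w ^ 2] := by
    rw [hj]
    refine (hmod.symm.add_right _).trans ?_
    rw [add_right_comm]
    exact hi'.add_right d
  refine ⟨(c + (w ^ 2 - m % w ^ 2)) % w ^ 2, Nat.mod_lt _ hL, ?_, ?_, ?_⟩
  · rw [hi', Nat.mod_eq_of_lt (by omega), Nat.div_eq_of_lt hc]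
  · rw [hi'', Nat.mod_eq_of_lt hjL, Nat.mul_div_cancel _ hw]; exact hj0
  · rw [hi'', Nat.mod_eq_of_lt hjL, Nat.mul_mod_left]

theorem exists_marker_offset {w m m' : ℕ} (hw : 2 ≤ w) (h : ¬ m ≡ m' [MOD w ^ 2]) :
    ∃ i < w ^ 2,
      ((m + i) % w ^ 2 / w = 0 ∧ (m' + i) % w ^ 2 / w ≠ 0 ∧ (m' + i) % w ^ 2 % w = 0) ∨
      ((m' + i) % w ^ 2 / w = 0 ∧ (m + i) % w ^ 2 / w ≠ 0 ∧ (m + i) % w ^ 2 % w = 0) := by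
  wlog hlt : m % w ^ 2 < m' % w ^ 2 generalizing m m'
  · obtain ⟨i, hi, h'⟩ := this (fun h' => h h'.symm)
      (lt_of_le_of_ne (not_lt.1 hlt) fun h' => h h'.symm)
    exact ⟨i, hi, h'.symm⟩
  have hL : 2 * w ≤ w ^ 2 := by nlinarith
  have hm' := Nat.mod_lt m' (show 0 < w ^ 2 by omega)
  have hma := Nat.mod_modEq m (w ^ 2)
  have hmb := Nat.mod_modEq m' (w ^ 2)
  generalize m % w ^ 2 = a at *
  generalize m' % w ^ 2 = b at *
  by_cases hle : b - a ≤ w ^ 2 - w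
  · obtain ⟨i, hi, h'⟩ := exists_marker_offset_of_add_modEq (w := w) (m := m) (m' := m')
      (show b - a ≠ 0 by omega) hle
      ((hma.symm.add_right _).trans (by rwa [Nat.add_sub_cancel' hlt.le]))
    exact ⟨i, hi, Or.inl h'⟩
  · obtain ⟨i, hi, h'⟩ := exists_marker_offset_of_add_modEq (w := w) (m := m') (m' := m)
      (show w ^ 2 - (b - a) ≠ 0 by omega) (by omega)
      ((hmb.symm.add_right _).trans (by
        rw [show b + (w ^ 2 - (b - a)) = a + w ^ 2 by omega]
        exact (Nat.add_mod_right a _).trans hma))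
    exact ⟨i, hi, Or.inr h'⟩

theorem exists_parameters {t M : ℕ} (ht : 1 ≤ t) (hM : 2 ≤ M) {R : ℝ} (hR0 : 0 < R)
    (hR1 : R < Real.logb 2 (M : ℝ) / (t : ℝ)) (K : ℕ) :
    ∃ h p r : ℕ, 1 ≤ h ∧ p.Prime ∧ p ≤ M ^ (t * h * h) ∧ r ≠ 0 ∧ K ≤ r ∧
      (2 : ℝ) ^ (R * (((t * h + 1) ^ 2 * (r + 1) : ℕ) : ℝ)) ≤ (p : ℝ) ^ r := by
  have ht' : (1 : ℝ) ≤ t := by exact_mod_cast ht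
  set C := Real.logb 2 (M : ℝ) / (t : ℝ) with hC
  have hCt : Real.logb 2 (M : ℝ) = C * t := by rw [hC]; field_simp
  obtain ⟨h, hh⟩ := exists_nat_gt ((3 * R + 1) / (C - R))
  have hCR : 0 < C - R := sub_pos.2 hR1
  rw [div_lt_iff₀ hCR] at hh
  have hpos : 1 ≤ h := by
    rcases Nat.eq_zero_or_pos h with rfl | h0
    · simp at hh; linarith
    · exact h0
  have hpos' : (1 : ℝ) ≤ h := by exact_mod_cast hpos
  have hQ : 2 ≤ M ^ (t * h * h) := by
    calc 2 ≤ M := hM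
      _ ≤ _ := Nat.le_self_pow (by positivity) M
  obtain ⟨p, hp, hlt, hle⟩ :=
    Nat.exists_prime_lt_and_le_two_mul (M ^ (t * h * h) / 2) (by omega)
  have hpQ : M ^ (t * h * h) ≤ 2 * p := by omega
  have hp0 : (0 : ℝ) < p := by exact_mod_cast hp.pos
  have hlog : C * t * (t * h * h) ≤ 1 + Real.logb 2 p := by
    have h1 : Real.logb 2 ((M : ℝ) ^ (t * h * h)) ≤ Real.logb 2 (2 * p) :=
      Real.logb_le_logb_of_le (by norm_num) (by positivity) (by exact_mod_cast hpQ)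
    rw [Real.logb_pow, Real.logb_mul (by norm_num) hp0.ne', hCt,
      Real.logb_self_eq_one (by norm_num)] at h1
    push_cast at h1
    linarith
  have hgap : 0 < Real.logb 2 p - R * (t * h + 1) ^ 2 := by
    have hy : (h : ℝ) ≤ t * h := by nlinarith
    have hy2 : 3 * R + 1 < t * h * (C - R) := by nlinarith
    have hy1 : (1 : ℝ) ≤ t * h := by linarith
    nlinarith
  obtain ⟨r, hr⟩ := exists_nat_gt (R * (t * h + 1) ^ 2 / (Real.logb 2 p - R * (t * h + 1) ^ 2))
  rw [div_lt_iff₀ hgap] at hr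
  refine ⟨h, p, max (max r K) 1, hpos, hp, by omega, by simp, by simp, ?_⟩
  have hrm : (r : ℝ) ≤ (max (max r K) 1 : ℕ) := by exact_mod_cast (by simp)
  generalize max (max r K) 1 = r' at hrm
  rw [← Real.le_logb_iff_rpow_le (by norm_num) (by positivity), Real.logb_pow]
  push_cast
  nlinarith

theorem stmt9 {V : Type*} [Fintype V] (G : SimpleGraph V)
    (t : ℕ) (ht : 1 ≤ t) (S : Finset (Fin t → V)) (hS : 2 ≤ S.card)
    (hdist : ∀ u ∈ S, ∀ v ∈ S, u ≠ v → ∃ i : Fin t, u i ≠ v i ∧ ¬G.Adj (u i) (v i))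
    (R : ℝ) (hR0 : 0 < R) (hR1 : R < Real.logb 2 (S.card : ℝ) / (t : ℝ)) (K : ℕ) :
    ∃ k : ℕ, K ≤ k ∧ ∃ n : ℕ, (2 : ℝ) ^ (R * k) ≤ n ∧
      ∃ x : ZMod n → V, ∀ m m' : ZMod n, m ≠ m' →
        ∃ i : Fin k, win k x m i ≠ win k x m' i ∧
          ¬G.Adj (win k x m i) (win k x m' i) := by
  obtain ⟨h, p, r, hh, hp, hpS, hr0, hKr, hrate⟩ := exists_parameters ht hS hR0 hR1 K
  have : Fact p.Prime := ⟨hp⟩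
  obtain ⟨s, hs, hsinj⟩ := exists_periodic_window_injective p r hr0
  set N := p ^ r - 1 with hN
  have hpr : 2 ≤ p ^ r := hp.two_le.trans (Nat.le_self_pow hr0 p)
  obtain ⟨w, hw⟩ : ∃ w, w = t * h + 1 := ⟨_, rfl⟩
  have hth : 1 ≤ t * h := Nat.mul_pos ht hh
  have hw2 : 2 ≤ w := by omega
  set L := w ^ 2 with hL
  have hL4 : 4 ≤ L := by nlinarith
  obtain ⟨u₀, hu₀, v₀, hv₀, huv⟩ := Finset.one_lt_card.1 hS
  obtain ⟨i₀, hab, hnadj⟩ := hdist u₀ hu₀ v₀ hv₀ huv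
  obtain ⟨word⟩ : Nonempty (ZMod p ↪ (Fin (t * h) × Fin h → S)) := by
    rw [Function.Embedding.nonempty_iff_card_le]
    simpa [ZMod.card, mul_assoc] using hpS
  -- A block carries the marker in row `0` and column `0`, and the word in the other entries.
  let block : ZMod p → ℕ → V := fun c i =>
    if i / w = 0 then u₀ i₀ else if i % w = 0 then v₀ i₀ else
      if hi : i / w - 1 < t * h ∧ (i % w - 1) / t < h then
        (word c (⟨i / w - 1, hi.1⟩, ⟨(i % w - 1) / t, hi.2⟩) : Fin t → V)
          ⟨(i % w - 1) % t, Nat.mod_lt _ ht⟩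
      else u₀ i₀
  let X : ℕ → V := fun j => block (s (j / L)) (j % L)
  have hrow : ∀ c i, i / w = 0 → block c i = u₀ i₀ := fun c i h => if_pos h
  have hcolumn : ∀ c i, i / w ≠ 0 → i % w = 0 → block c i = v₀ i₀ := fun c i h h' =>
    (if_neg h).trans (if_pos h')
  have hblock : ∀ c c', c ≠ c' → ∃ i < L, block c i ≠ block c' i ∧
      ¬G.Adj (block c i) (block c' i) := by
    intro c c' hcc
    obtain ⟨⟨q, e⟩, hqe⟩ := Function.ne_iff.1 (word.injective.ne hcc)
    obtain ⟨o, ho⟩ := hdist _ (word c (q, e)).2 _ (word c' (q, e)).2 (Subtype.coe_injective.ne hqe)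
    have hcol : e.1 * t + o.1 + 1 < w := by
      have : (e.1 + 1) * t ≤ h * t := Nat.mul_le_mul_right t e.2
      have := o.2
      rw [hw, mul_comm t h]
      nlinarith
    have hq := q.2
    have hi : ∀ c, block c (e.1 * t + o.1 + 1 + w * (q.1 + 1)) = (word c (q, e) : Fin t → V) o := by
      intro c
      have h1 : (e.1 * t + o.1 + 1 + w * (q.1 + 1)) / w = q.1 + 1 := by
        rw [Nat.add_mul_div_left _ _ (by omega), Nat.div_eq_of_lt hcol, zero_add]
      have h2 : (e.1 * t + o.1 + 1 + w * (q.1 + 1)) % w = e.1 * t + o.1 + 1 := by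
        rw [Nat.add_mul_mod_self_left, Nat.mod_eq_of_lt hcol]
      have h3 : (e.1 * t + o.1) / t = e.1 := by
        rw [mul_comm, Nat.mul_add_div ht, Nat.div_eq_of_lt o.2, add_zero]
      have h4 : (e.1 * t + o.1) % t = o.1 := by
        rw [mul_comm, Nat.mul_add_mod, Nat.mod_eq_of_lt o.2]
      simp [block, h1, h2, h3, h4, -Nat.div_eq_zero_iff]
    refine ⟨e.1 * t + o.1 + 1 + w * (q.1 + 1), ?_, ?_⟩
    · rw [hL]; nlinarith
    · rw [hi, hi]; exact ho
  have hNpos : 0 < N := by omega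
  have hX : Function.Periodic X (L * N) := by
    intro j
    have h1 : (j + L * N) / L = j / L + N := Nat.add_mul_div_left _ _ (by omega)
    simp only [X, h1, hs (j / L), Nat.add_mul_mod_self_left]
  have : NeZero (L * N) := ⟨by positivity⟩
  refine ⟨L * (r + 1), by nlinarith, L * N, ?_, fun z => X z.val, fun m m' hmm => ?_⟩
  · rw [← hw] at hrate
    refine hrate.trans ?_
    have : p ^ r ≤ L * N := by
      have : 4 * N ≤ L * N := Nat.mul_le_mul_right N hL4
      omega
    exact_mod_cast this
  have hwin : ∀ (m : ZMod (L * N)) (i : Fin (L * (r + 1))),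
      win (L * (r + 1)) (fun z : ZMod (L * N) => X z.val) m i = X (m.val + i) := by
    intro m i
    simp only [win]
    rw [ZMod.val_add, ZMod.val_natCast, Nat.add_mod_mod, hX.map_mod_nat]
  suffices ∃ i < L * (r + 1), X (m.val + i) ≠ X (m'.val + i) ∧
      ¬G.Adj (X (m.val + i)) (X (m'.val + i)) by
    obtain ⟨i, hi, hne⟩ := this
    exact ⟨⟨i, hi⟩, by simpa only [hwin] using hne⟩
  by_cases hmod : m.val ≡ m'.val [MOD L]
  · have hdm := Nat.div_add_mod m.val L
    have hdm' := Nat.div_add_mod m'.val L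
    have hmL := Nat.mod_lt m.val (show 0 < L by omega)
    have hmm' : m.val % L = m'.val % L := hmod
    obtain ⟨l, hl, hsl⟩ : ∃ l < r, s (m.val / L + 1 + l) ≠ s (m'.val / L + 1 + l) := by
      by_contra! hcon
      have h1 := Nat.ModEq.add_right_cancel' 1 (hsinj _ _ hcon)
      have h2 := h1.eq_of_lt_of_lt (Nat.div_lt_of_lt_mul m.val_lt) (Nat.div_lt_of_lt_mul m'.val_lt)
      apply hmm
      apply ZMod.val_injective
      rw [← hdm, ← hdm', h2, hmm']
    obtain ⟨i, hi, hne⟩ := hblock _ _ hsl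
    have hval : ∀ B, X (i + L * B) = block (s B) i := by
      intro B
      simp only [X]
      rw [Nat.add_mul_div_left _ _ (by omega), Nat.div_eq_of_lt hi, zero_add,
        Nat.add_mul_mod_self_left, Nat.mod_eq_of_lt hi]
    refine ⟨i + L * (l + 1) - m.val % L, ?_, ?_⟩
    · have h1 : L * (l + 1) ≤ L * r := Nat.mul_le_mul_left L hl
      rw [mul_add L r 1]
      have h2 : L ≤ L * (l + 1) := Nat.le_mul_of_pos_right L (by omega)
      omega
    · have h2 : L ≤ L * (l + 1) := Nat.le_mul_of_pos_right L (by omega)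
      have e1 : m.val + (i + L * (l + 1) - m.val % L) = i + L * (m.val / L + 1 + l) := by
        rw [add_assoc, add_comm 1 l, mul_add L (_ / L)]; omega
      have e2 : m'.val + (i + L * (l + 1) - m.val % L) = i + L * (m'.val / L + 1 + l) := by
        rw [add_assoc, add_comm 1 l, mul_add L (_ / L)]; omega
      rw [e1, e2, hval, hval]
      exact hne
  · obtain ⟨i, hi, hor⟩ := exists_marker_offset hw2 hmod
    rw [← hL] at hor
    refine ⟨i, hi.trans_le (Nat.le_mul_of_pos_right L (by omega)), ?_⟩
    rcases hor with ⟨h1, h2, h3⟩ | ⟨h1, h2, h3⟩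
    · simp only [X, hrow _ _ h1, hcolumn _ _ h2 h3]
      exact ⟨hab, hnadj⟩
    · simp only [X, hrow _ _ h1, hcolumn _ _ h2 h3]
      exact ⟨hab.symm, fun h => hnadj h.symm⟩
end
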